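/- Let 𝒜 = Σ_{ℓ=1}^d A_ℓ ∂_ℓ be a first-order homogeneous constant-coefficient operator with A_ℓ ∈ ℝ^{n×m}, let Ω ⊂ ℝ^d be open with 0 ∈ Ω, and let μ be a finite ℝ^m-valued Radon measure on Ω which is 𝒜-free. Let P₀ := dμ/d|μ|(0) (assumed to exist as a limit of averages in the sense of the Besicovitch derivation theorem) and suppose there are radii r_j ↓ 0 with B_{r_j}(0) ⊂ Ω such that: (i) |μ^a|(B_{r_j})/|μ^s|(B_{r_j}) → 0 and (1/|μ^s|(B_{r_j})) ∫_{B_{r_j}} | dμ/d|μ|(x) − P₀ | d|μ^s|(x) → 0 as j → ∞; (ii) the rescaled measures ν_j, defined by ν_j(B) := |μ^s|(r_j B)/|μ^s|(B_{r_j}) for Borel B ⊂ B₁, converge weakly* to a positive Radon measure ν on B₁ with ν(B_{1/2}) > 0; (iii) there exists c > 0 such that | (Σ_{ℓ=1}^d ξ_ℓ A_ℓ) P₀ | ≥ c |ξ| for all ξ ∈ ℝ^d. Then the restriction of ν to B_{1/2} is nonzero and absolutely continuous with respect to ℒ^d, and moreover |ν_j − ν|(B_{1/2}) → 0, i.e.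 ν_j converges to ν in total variation on B_{1/2}. -/

import Mathlib

open MeasureTheory Metric Filter Topology
open scoped ENNReal

/-- The partial derivative `∂_ℓ φ` of a scalar function on `ℝ^d`. -/
noncomputable def pderiv' {d : ℕ} (l : Fin d) (φ : EuclideanSpace ℝ (Fin d) → ℝ) :
    EuclideanSpace ℝ (Fin d) → ℝ :=
  fun x => fderiv ℝ φ x (EuclideanSpace.single l 1)

section

open scoped FourierTransform SchwartzMap LineDeriv ContDiff

theorem norm_sq_symbol_le {d : ℕ} {a : ℝ} (ha : 0 < a) (ξ : EuclideanSpace ℝ (Fin d))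
    (hξ : a ≤ ‖ξ‖) (G : ℂ) (W : Fin d → Fin d → ℂ) (r : Fin d → ℂ)
    (h : ∀ k, (2 * Real.pi * Complex.I) * (ξ k * G)
      = (∑ l, (2 * Real.pi * Complex.I) * (ξ l * W k l)) + r k) :
    ‖G‖ ^ 2 ≤ 2 * (d + 1) * ((∑ k, ∑ l, ‖W k l‖ ^ 2) + (a ^ 2)⁻¹ * ∑ k, ‖r k‖ ^ 2) := by
  have hcoord : ∀ l, |ξ l| ≤ ‖ξ‖ := fun l => by
    simpa using PiLp.norm_apply_le ξ l
  have h1 : ∀ k, |ξ k| * ‖G‖ ≤ ‖ξ‖ * (∑ l, ‖W k l‖) + ‖r k‖ := by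
    intro k
    have hpi : (1 : ℝ) ≤ 2 * Real.pi := by linarith [Real.pi_gt_three]
    have hn : ‖(2 * Real.pi * Complex.I : ℂ)‖ = 2 * Real.pi := by
      simp [abs_of_pos Real.pi_pos]
    have h2 : ‖(2 * Real.pi * Complex.I : ℂ) * (ξ k * G)‖
        ≤ ∑ l, ‖(2 * Real.pi * Complex.I : ℂ) * (ξ l * W k l)‖ + ‖r k‖ := by
      rw [h k]
      exact (norm_add_le _ _).trans (by gcongr; exact norm_sum_le _ _)
    simp only [norm_mul, hn, Complex.norm_real, Real.norm_eq_abs] at h2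
    have h3 : ∑ l, 2 * Real.pi * (|ξ l| * ‖W k l‖) ≤ 2 * Real.pi * (‖ξ‖ * ∑ l, ‖W k l‖) := by
      rw [← Finset.mul_sum, Finset.mul_sum _ _ ‖ξ‖]
      gcongr with l
      exact hcoord l
    have h4 : ‖r k‖ ≤ 2 * Real.pi * ‖r k‖ := le_mul_of_one_le_left (norm_nonneg _) hpi
    have h5 : 2 * Real.pi * (|ξ k| * ‖G‖)
        ≤ 2 * Real.pi * (‖ξ‖ * (∑ l, ‖W k l‖) + ‖r k‖) := by
      linarith
    exact le_of_mul_le_mul_left h5 (by linarith)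
  have h2 : ∀ k, |ξ k| ^ 2 * ‖G‖ ^ 2
      ≤ 2 * (d + 1) * (‖ξ‖ ^ 2 * (∑ l, ‖W k l‖ ^ 2) + ‖r k‖ ^ 2) := by
    intro k
    have hcs : (∑ l, ‖W k l‖) ^ 2 ≤ d * ∑ l, ‖W k l‖ ^ 2 := by
      simpa using sq_sum_le_card_mul_sum_sq (s := Finset.univ) (f := fun l => ‖W k l‖)
    have hs : (|ξ k| * ‖G‖) ^ 2 ≤ (‖ξ‖ * (∑ l, ‖W k l‖) + ‖r k‖) ^ 2 := by
      gcongr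
      exact h1 k
    have hS : 0 ≤ ∑ l, ‖W k l‖ ^ 2 := Finset.sum_nonneg fun l _ => by positivity
    have hd : (0 : ℝ) ≤ d := Nat.cast_nonneg d
    have := mul_le_mul_of_nonneg_left hcs (sq_nonneg ‖ξ‖)
    nlinarith [sq_nonneg (‖ξ‖ * ∑ l, ‖W k l‖ - ‖r k‖), mul_nonneg hd (sq_nonneg ‖r k‖),
      mul_nonneg (sq_nonneg ‖ξ‖) hS]
  have h3 : ‖ξ‖ ^ 2 * ‖G‖ ^ 2
      ≤ 2 * (d + 1) * (‖ξ‖ ^ 2 * (∑ k, ∑ l, ‖W k l‖ ^ 2) + ∑ k, ‖r k‖ ^ 2) := by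
    have := Finset.sum_le_sum fun k (_ : k ∈ Finset.univ) => h2 k
    rw [← Finset.sum_mul, ← Finset.mul_sum, Finset.sum_add_distrib, ← Finset.mul_sum] at this
    rw [EuclideanSpace.norm_sq_eq ξ]
    simpa [EuclideanSpace.norm_sq_eq] using this
  have hξ2 : a ^ 2 ≤ ‖ξ‖ ^ 2 := by gcongr
  have ha2 : 0 < a ^ 2 := by positivity
  have hR : 0 ≤ ∑ k, ‖r k‖ ^ 2 := Finset.sum_nonneg fun l _ => by positivity
  have h4 : ∑ k, ‖r k‖ ^ 2 ≤ ‖ξ‖ ^ 2 * ((a ^ 2)⁻¹ * ∑ k, ‖r k‖ ^ 2) := by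
    calc ∑ k, ‖r k‖ ^ 2 = a ^ 2 * ((a ^ 2)⁻¹ * ∑ k, ‖r k‖ ^ 2) := by field_simp
      _ ≤ _ := by gcongr
  have hd : (0 : ℝ) ≤ 2 * (d + 1) := by positivity
  refine le_of_mul_le_mul_left ?_ (ha2.trans_le hξ2)
  nlinarith [mul_le_mul_of_nonneg_left h4 hd]

/-- A real smooth compactly supported function, as a complex Schwartz function. -/
noncomputable def complexSchwartz {d : ℕ} {f : EuclideanSpace ℝ (Fin d) → ℝ}
    (hf : ContDiff ℝ ∞ f) (hc : HasCompactSupport f) : 𝓢(EuclideanSpace ℝ (Fin d), ℂ) :=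
  (hc.comp_left (g := Complex.ofReal) Complex.ofReal_zero).toSchwartzMap
    (Complex.ofRealCLM.contDiff.comp hf)

theorem complexSchwartz_apply {d : ℕ} {f : EuclideanSpace ℝ (Fin d) → ℝ}
    (hf : ContDiff ℝ ∞ f) (hc : HasCompactSupport f) (x : EuclideanSpace ℝ (Fin d)) :
    complexSchwartz hf hc x = f x := rfl

theorem lineDeriv_complexSchwartz {d : ℕ} {f : EuclideanSpace ℝ (Fin d) → ℝ}
    (hf : ContDiff ℝ ∞ f) (hc : HasCompactSupport f) (l : Fin d)
    (x : EuclideanSpace ℝ (Fin d)) :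
    (∂_{EuclideanSpace.single l (1 : ℝ)} (complexSchwartz hf hc)) x = (pderiv' l f x : ℂ) := by
  rw [SchwartzMap.lineDerivOp_apply_eq_fderiv]
  have h : HasFDerivAt (fun y => complexSchwartz hf hc y)
      (Complex.ofRealCLM.comp (fderiv ℝ f x)) x :=
    Complex.ofRealCLM.hasFDerivAt.comp x (hf.differentiable (by simp) x).hasFDerivAt
  rw [show (⇑(complexSchwartz hf hc)) = fun y => complexSchwartz hf hc y from rfl, h.fderiv]
  rfl

theorem fourier_lineDeriv_apply {d : ℕ} (f : 𝓢(EuclideanSpace ℝ (Fin d), ℂ)) (l : Fin d)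
    (ξ : EuclideanSpace ℝ (Fin d)) :
    𝓕 (∂_{EuclideanSpace.single l (1 : ℝ)} f) ξ
      = (2 * Real.pi * Complex.I) * (ξ l * 𝓕 f ξ) := by
  rw [SchwartzMap.fourier_lineDerivOp_eq]
  have : (inner ℝ · (EuclideanSpace.single l (1 : ℝ)) :
      EuclideanSpace ℝ (Fin d) → ℝ).HasTemperateGrowth :=
    ((innerSL ℝ).flip _).hasTemperateGrowth
  rw [smul_apply, SchwartzMap.smulLeftCLM_apply_apply this]
  simp [EuclideanSpace.inner_single_right]

theorem integral_norm_sq_fourier_complexSchwartz {d : ℕ} {f : EuclideanSpace ℝ (Fin d) → ℝ}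
    (hf : ContDiff ℝ ∞ f) (hc : HasCompactSupport f) :
    ∫ ξ, ‖𝓕 (complexSchwartz hf hc) ξ‖ ^ 2 = ∫ x, f x ^ 2 := by
  rw [SchwartzMap.integral_norm_sq_fourier]
  simp [complexSchwartz_apply]

theorem SchwartzMap.integrable_norm_sq {d : ℕ} (f : 𝓢(EuclideanSpace ℝ (Fin d), ℂ)) :
    Integrable fun x => ‖f x‖ ^ 2 :=
  (f.memLp 2 volume).integrable_norm_pow (by norm_num)

theorem sq_integral_le_measureReal_mul_integral_sq {α : Type*} [MeasurableSpace α]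
    (μ : Measure α) [IsFiniteMeasure μ] {u : α → ℝ} (hu : Integrable u μ)
    (hu2 : Integrable (fun x => u x ^ 2) μ) :
    (∫ x, u x ∂μ) ^ 2 ≤ μ.real Set.univ * ∫ x, u x ^ 2 ∂μ := by
  obtain ⟨V, hV⟩ : ∃ V, V = μ.real Set.univ := ⟨_, rfl⟩
  obtain ⟨I, hI⟩ : ∃ I, I = ∫ x, u x ∂μ := ⟨_, rfl⟩
  obtain ⟨J, hJ⟩ : ∃ J, J = ∫ x, u x ^ 2 ∂μ := ⟨_, rfl⟩
  have hV0 : 0 ≤ V := hV ▸ measureReal_nonneg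
  have h0 : 0 ≤ ∫ x, (V * u x - I) ^ 2 ∂μ := integral_nonneg fun x => sq_nonneg _
  have e3 : ∫ x, (V * u x - I) ^ 2 ∂μ = V ^ 2 * J - 2 * V * I * I + I ^ 2 * V := by
    have h1 : ∀ x, (V * u x - I) ^ 2 = V ^ 2 * u x ^ 2 - 2 * V * I * u x + I ^ 2 :=
      fun x => by ring
    rw [integral_congr_ae (Eventually.of_forall h1),
      integral_add (by exact (hu2.const_mul _).sub (hu.const_mul _)) (integrable_const _),
      integral_sub (hu2.const_mul _) (hu.const_mul _), integral_const_mul, integral_const_mul,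
      integral_const, smul_eq_mul, ← hV, ← hI, ← hJ, mul_comm V]
  rw [← hV, ← hI, ← hJ]
  rcases hV0.eq_or_lt with h | h
  · have hμ : μ = 0 := by
      rw [← Measure.measure_univ_eq_zero]
      rw [← h] at hV
      exact (measureReal_eq_zero_iff).1 hV.symm
    simp [hI, ← h, hμ]
  · rw [e3] at h0
    refine le_of_mul_le_mul_left ?_ h
    nlinarith

theorem sq_integral_abs_le_of_support_subset_ball {d : ℕ} {g : EuclideanSpace ℝ (Fin d) → ℝ}
    (hg : Continuous g) (hgc : HasCompactSupport g) (hsupp : ∀ x, x ∉ ball 0 1 → g x = 0) :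
    (∫ x, |g x|) ^ 2 ≤ volume.real (ball (0 : EuclideanSpace ℝ (Fin d)) 1) * ∫ x, g x ^ 2 := by
  have hi1 : Integrable fun x => |g x| := (hg.integrable_of_hasCompactSupport hgc).abs
  have hi2 : Integrable fun x => g x ^ 2 := by
    simp_rw [sq]
    exact (hg.mul hg).integrable_of_hasCompactSupport hgc.mul_right
  have e1 : ∫ x in ball (0 : EuclideanSpace ℝ (Fin d)) 1, |g x| = ∫ x, |g x| :=
    setIntegral_eq_integral_of_forall_compl_eq_zero fun x hx => by rw [hsupp x hx, abs_zero]
  have e2 : ∫ x in ball (0 : EuclideanSpace ℝ (Fin d)) 1, |g x| ^ 2 = ∫ x, g x ^ 2 := by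
    simp_rw [sq_abs]
    exact setIntegral_eq_integral_of_forall_compl_eq_zero fun x hx => by simp [hsupp x hx]
  have : IsFiniteMeasure (volume.restrict (ball (0 : EuclideanSpace ℝ (Fin d)) 1)) :=
    ⟨by simpa using measure_ball_lt_top⟩
  have := sq_integral_le_measureReal_mul_integral_sq
    (volume.restrict (ball (0 : EuclideanSpace ℝ (Fin d)) 1)) hi1.integrableOn
    (by simp_rw [sq_abs]; exact hi2.integrableOn)
  rwa [e1, e2, measureReal_restrict_apply_univ] at this

theorem norm_fourier_complexSchwartz_le {d : ℕ} {f : EuclideanSpace ℝ (Fin d) → ℝ}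
    (hf : ContDiff ℝ ∞ f) (hc : HasCompactSupport f) (ξ : EuclideanSpace ℝ (Fin d)) :
    ‖𝓕 (complexSchwartz hf hc) ξ‖ ≤ ∫ x, |f x| := by
  refine (SchwartzMap.norm_fourier_apply_le_toLp_one _ ξ).trans ?_
  rw [SchwartzMap.norm_toLp_one]
  simp [complexSchwartz_apply]

/-- A compactly supported function whose gradient is the divergence of a matrix field, up to an
`L²` remainder, is controlled in `L²` by the matrix field and the remainder. -/
theorem exists_integral_sq_le_of_grad_eq_div {d : ℕ} (hd : 0 < d) :
    ∃ C : ℝ, 0 < C ∧ ∀ (g : EuclideanSpace ℝ (Fin d) → ℝ)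
      (W : Fin d → Fin d → EuclideanSpace ℝ (Fin d) → ℝ)
      (r : Fin d → EuclideanSpace ℝ (Fin d) → ℝ),
      ContDiff ℝ ∞ g → HasCompactSupport g → (∀ x, x ∉ ball 0 1 → g x = 0) →
      (∀ k l, ContDiff ℝ ∞ (W k l)) → (∀ k l, HasCompactSupport (W k l)) →
      (∀ k, ContDiff ℝ ∞ (r k)) → (∀ k, HasCompactSupport (r k)) →
      (∀ k x, pderiv' k g x = ∑ l, pderiv' l (W k l) x + r k x) →
      ∫ x, g x ^ 2 ≤ C * ((∑ k, ∑ l, ∫ x, W k l x ^ 2) + ∑ k, ∫ x, r k x ^ 2) := by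
  have : Nonempty (Fin d) := ⟨⟨0, hd⟩⟩
  set V := volume.real (ball (0 : EuclideanSpace ℝ (Fin d)) 1) with hV
  have hVpos : 0 < V := by
    rw [hV, measureReal_def]
    exact ENNReal.toReal_pos (measure_ball_pos _ _ one_pos).ne' measure_ball_lt_top.ne
  set a : ℝ := (2 * V ^ 2 + 2)⁻¹ with ha
  have hapos : 0 < a := by positivity
  have ha1 : a ≤ 1 := by
    rw [ha]; apply inv_le_one_of_one_le₀; nlinarith
  have haV : volume.real (ball (0 : EuclideanSpace ℝ (Fin d)) a) * V ≤ 1 / 2 := by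
    have h1 : volume.real (ball (0 : EuclideanSpace ℝ (Fin d)) a) = a ^ d * V := by
      rw [measureReal_def, Measure.addHaar_ball _ _ hapos.le, ENNReal.toReal_mul,
        ENNReal.toReal_ofReal (by positivity)]
      simp [hV, measureReal_def]
    have h2 : a ^ d ≤ a := pow_le_of_le_one hapos.le ha1 hd.ne'
    rw [h1]
    calc a ^ d * V * V ≤ a * V * V := by gcongr
      _ ≤ 1 / 2 := by
        rw [ha, mul_assoc, inv_mul_le_iff₀ (by positivity)]; nlinarith
  refine ⟨4 * (d + 1) * (1 + (a ^ 2)⁻¹), by positivity, ?_⟩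
  intro g W r hg hgc hsupp hW hWc hr hrc heq
  set G := complexSchwartz hg hgc
  set WW := fun k l => complexSchwartz (hW k l) (hWc k l)
  set R := fun k => complexSchwartz (hr k) (hrc k)
  have hS : ∀ k, ∂_{EuclideanSpace.single k (1 : ℝ)} G
      = ∑ l, ∂_{EuclideanSpace.single l (1 : ℝ)} (WW k l) + R k := by
    intro k
    ext x
    rw [add_apply, sum_apply]
    simp only [G, WW, R, lineDeriv_complexSchwartz, complexSchwartz_apply, heq k x]
    push_cast
    rfl
  have hF : ∀ ξ k, (2 * Real.pi * Complex.I) * (ξ k * 𝓕 G ξ)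
      = ∑ l, (2 * Real.pi * Complex.I) * (ξ l * 𝓕 (WW k l) ξ) + 𝓕 (R k) ξ := by
    intro ξ k
    rw [← fourier_lineDeriv_apply, hS k, FourierTransform.fourier_add,
      FourierTransform.fourier_sum, add_apply, sum_apply]
    simp only [fourier_lineDeriv_apply]
  set S : EuclideanSpace ℝ (Fin d) → ℝ := fun ξ =>
    (∑ k, ∑ l, ‖𝓕 (WW k l) ξ‖ ^ 2) + (a ^ 2)⁻¹ * ∑ k, ‖𝓕 (R k) ξ‖ ^ 2 with hSdef
  set J := ∫ x, g x ^ 2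
  have hJ : 0 ≤ J := integral_nonneg fun x => sq_nonneg _
  have hpt : ∀ ξ, ‖𝓕 G ξ‖ ^ 2 ≤ 2 * (d + 1) * S ξ
      + (ball (0 : EuclideanSpace ℝ (Fin d)) a).indicator (fun _ => V * J) ξ := by
    intro ξ
    have hS0 : 0 ≤ S ξ := by
      simp only [hSdef]; positivity
    by_cases hξ : a ≤ ‖ξ‖
    · have hm : ξ ∉ ball (0 : EuclideanSpace ℝ (Fin d)) a := by simpa using hξ
      rw [Set.indicator_of_notMem hm, add_zero]
      exact norm_sq_symbol_le hapos ξ hξ _ _ _ (hF ξ)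
    · have hm : ξ ∈ ball (0 : EuclideanSpace ℝ (Fin d)) a := by simpa using hξ
      rw [Set.indicator_of_mem hm]
      have h1 : ‖𝓕 G ξ‖ ^ 2 ≤ (∫ x, |g x|) ^ 2 := by
        gcongr
        exact norm_fourier_complexSchwartz_le hg hgc ξ
      have h2 := sq_integral_abs_le_of_support_subset_ball hg.continuous hgc hsupp
      have h3 : 0 ≤ 2 * (d + 1) * S ξ := by positivity
      linarith
  have hiW : ∀ k l, Integrable fun ξ => ‖𝓕 (WW k l) ξ‖ ^ 2 :=
    fun k l => SchwartzMap.integrable_norm_sq _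
  have hiR : ∀ k, Integrable fun ξ => ‖𝓕 (R k) ξ‖ ^ 2 := fun k => SchwartzMap.integrable_norm_sq _
  have hiS1 : Integrable fun ξ => ∑ k, ∑ l, ‖𝓕 (WW k l) ξ‖ ^ 2 :=
    integrable_finsetSum _ fun k _ => integrable_finsetSum _ fun l _ => hiW k l
  have hiS2 : Integrable fun ξ => ∑ k, ‖𝓕 (R k) ξ‖ ^ 2 :=
    integrable_finsetSum _ fun k _ => hiR k
  have hiS : Integrable S := hiS1.add (hiS2.const_mul _)
  have hiI : Integrable
      ((ball (0 : EuclideanSpace ℝ (Fin d)) a).indicator (fun _ => V * J)) :=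
    (integrable_indicator_iff measurableSet_ball).2 (integrableOn_const measure_ball_lt_top.ne)
  have hle := integral_mono (SchwartzMap.integrable_norm_sq (𝓕 G))
    ((hiS.const_mul (2 * ((d : ℝ) + 1))).add hiI) hpt
  have eG : ∫ ξ, ‖𝓕 G ξ‖ ^ 2 = J := integral_norm_sq_fourier_complexSchwartz hg hgc
  have eS : ∫ ξ, S ξ = (∑ k, ∑ l, ∫ x, W k l x ^ 2) + (a ^ 2)⁻¹ * ∑ k, ∫ x, r k x ^ 2 := by
    simp only [hSdef]
    rw [integral_add hiS1 (hiS2.const_mul _), integral_const_mul,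
      integral_finsetSum _ fun k _ => hiR k,
      integral_finsetSum _ fun k _ => integrable_finsetSum _ fun l _ => hiW k l]
    congr 1
    · refine Finset.sum_congr rfl fun k _ => ?_
      rw [integral_finsetSum _ fun l _ => hiW k l]
      exact Finset.sum_congr rfl fun l _ =>
        integral_norm_sq_fourier_complexSchwartz (hW k l) (hWc k l)
    · congr 1
      exact Finset.sum_congr rfl fun k _ =>
        integral_norm_sq_fourier_complexSchwartz (hr k) (hrc k)
  simp only [Pi.add_apply] at hle
  rw [eG, integral_add (hiS.const_mul _) hiI, integral_const_mul, eS,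
    integral_indicator measurableSet_ball, setIntegral_const, smul_eq_mul] at hle
  set P := ∑ k, ∑ l, ∫ x, W k l x ^ 2
  set Q := ∑ k, ∫ x, r k x ^ 2
  have hP : 0 ≤ P :=
    Finset.sum_nonneg fun k _ => Finset.sum_nonneg fun l _ => integral_nonneg fun x => sq_nonneg _
  have hQ : 0 ≤ Q := Finset.sum_nonneg fun k _ => integral_nonneg fun x => sq_nonneg _
  have h1 : volume.real (ball (0 : EuclideanSpace ℝ (Fin d)) a) * (V * J) ≤ 1 / 2 * J := by
    rw [← mul_assoc]; gcongr
  have h2 : J ≤ 4 * (d + 1) * (P + (a ^ 2)⁻¹ * Q) := by linarith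
  have h3 : P + (a ^ 2)⁻¹ * Q ≤ (1 + (a ^ 2)⁻¹) * (P + Q) := by
    have : 0 ≤ (a ^ 2)⁻¹ * P := by positivity
    nlinarith
  calc J ≤ 4 * (d + 1) * (P + (a ^ 2)⁻¹ * Q) := h2
    _ ≤ 4 * (d + 1) * ((1 + (a ^ 2)⁻¹) * (P + Q)) := by gcongr
    _ = _ := by ring

/-- Mollification of the measure `b μ` at the variable scale `t`:
`z ↦ ∫ b(x) t(x)⁻ᵈ ζ((z - x) / t(x)) dμ(x)`. -/
noncomputable def smear {d : ℕ} (μ : Measure (EuclideanSpace ℝ (Fin d)))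
    (b t ζ : EuclideanSpace ℝ (Fin d) → ℝ) (z : EuclideanSpace ℝ (Fin d)) : ℝ :=
  ∫ x, b x * ((t x)⁻¹ ^ d * ζ ((t x)⁻¹ • (z - x))) ∂μ

section Smear

variable {d : ℕ}

theorem contDiff_pderiv' {f : EuclideanSpace ℝ (Fin d) → ℝ} (hf : ContDiff ℝ ∞ f) (l : Fin d) :
    ContDiff ℝ ∞ (pderiv' l f) :=
  (hf.fderiv_right (m := ∞) (by simp)).clm_apply contDiff_const

theorem HasCompactSupport.pderiv' {f : EuclideanSpace ℝ (Fin d) → ℝ}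
    (hf : HasCompactSupport f) (l : Fin d) : HasCompactSupport (pderiv' l f) :=
  hf.fderiv_apply ℝ _

theorem exists_abs_le_of_hasCompactSupport {f : EuclideanSpace ℝ (Fin d) → ℝ}
    (hf : Continuous f) (hc : HasCompactSupport f) : ∃ M, 0 ≤ M ∧ ∀ x, |f x| ≤ M := by
  obtain ⟨M, hM⟩ := hf.bounded_above_of_compact_support hc
  exact ⟨M, (norm_nonneg _).trans (hM 0), hM⟩

theorem fderiv_apply_eq_sum (f : EuclideanSpace ℝ (Fin d) → ℝ) (x v : EuclideanSpace ℝ (Fin d)) :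
    fderiv ℝ f x v = ∑ l, v l * pderiv' l f x := by
  conv_lhs => rw [← (EuclideanSpace.basisFun (Fin d) ℝ).sum_repr v]
  simp [pderiv']

theorem measurable_smear_kernel {b t ζ : EuclideanSpace ℝ (Fin d) → ℝ} (hb : Measurable b)
    (ht : Measurable t) (hζ : Continuous ζ) :
    Measurable fun p : EuclideanSpace ℝ (Fin d) × EuclideanSpace ℝ (Fin d) =>
      b p.2 * ((t p.2)⁻¹ ^ d * ζ ((t p.2)⁻¹ • (p.1 - p.2))) := by
  have h1 : Measurable fun p : EuclideanSpace ℝ (Fin d) × EuclideanSpace ℝ (Fin d) => (t p.2)⁻¹ :=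
    (ht.comp measurable_snd).inv
  exact (hb.comp measurable_snd).mul ((h1.pow_const d).mul
    (hζ.measurable.comp (h1.smul (measurable_fst.sub measurable_snd))))

theorem abs_smear_kernel_le {b t ζ : EuclideanSpace ℝ (Fin d) → ℝ} {B M δ : ℝ}
    (hbB : ∀ x, |b x| ≤ B) (hδ : 0 < δ) (htδ : ∀ x, δ ≤ t x) (hM : ∀ x, |ζ x| ≤ M)
    (x z : EuclideanSpace ℝ (Fin d)) :
    |b x * ((t x)⁻¹ ^ d * ζ ((t x)⁻¹ • (z - x)))| ≤ B * (δ⁻¹ ^ d * M) := by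
  have hB : 0 ≤ B := (abs_nonneg _).trans (hbB x)
  have htx : 0 < t x := hδ.trans_le (htδ x)
  rw [abs_mul, abs_mul, abs_of_nonneg (by positivity : 0 ≤ (t x)⁻¹ ^ d)]
  gcongr
  · exact hbB x
  · exact htδ x
  · exact hM _

theorem integrable_smear_kernel {μ : Measure (EuclideanSpace ℝ (Fin d))} [IsFiniteMeasure μ]
    {b t ζ : EuclideanSpace ℝ (Fin d) → ℝ} {B δ : ℝ} (hb : Measurable b)
    (hbB : ∀ x, |b x| ≤ B) (ht : Measurable t) (hδ : 0 < δ) (htδ : ∀ x, δ ≤ t x)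
    (hζ : Continuous ζ) (hζc : HasCompactSupport ζ) (z : EuclideanSpace ℝ (Fin d)) :
    Integrable (fun x => b x * ((t x)⁻¹ ^ d * ζ ((t x)⁻¹ • (z - x)))) μ := by
  obtain ⟨M, -, hM⟩ := exists_abs_le_of_hasCompactSupport hζ hζc
  exact Integrable.of_bound
    ((measurable_smear_kernel hb ht hζ).comp measurable_prodMk_left).aestronglyMeasurable
    (B * (δ⁻¹ ^ d * M)) (Eventually.of_forall fun x => abs_smear_kernel_le hbB hδ htδ hM x z)

theorem integrable_sum_smul_const {α ι G : Type*} [MeasurableSpace α] [Fintype ι]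
    [NormedAddCommGroup G] [NormedSpace ℝ G] {μ : Measure α} {u : ι → α → ℝ}
    (hu : ∀ l, Integrable (u l) μ) (c : ι → G) : Integrable (fun x => ∑ l, u l x • c l) μ :=
  integrable_finsetSum _ fun l _ => (hu l).smul_const _

theorem integral_sum_smul_const {α ι G : Type*} [MeasurableSpace α] [Fintype ι]
    [NormedAddCommGroup G] [NormedSpace ℝ G] [CompleteSpace G] {μ : Measure α} {u : ι → α → ℝ}
    (hu : ∀ l, Integrable (u l) μ) (c : ι → G) :
    ∫ x, ∑ l, u l x • c l ∂μ = ∑ l, (∫ x, u l x ∂μ) • c l := by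
  rw [integral_finsetSum _ fun l _ => (hu l).smul_const _]
  exact Finset.sum_congr rfl fun l _ => integral_smul_const _ _

theorem hasFDerivAt_smear {μ : Measure (EuclideanSpace ℝ (Fin d))} [IsFiniteMeasure μ]
    {b t ζ : EuclideanSpace ℝ (Fin d) → ℝ} {B δ : ℝ} (hb : Measurable b)
    (hbB : ∀ x, |b x| ≤ B) (ht : Measurable t) (hδ : 0 < δ) (htδ : ∀ x, δ ≤ t x)
    (hζ : ContDiff ℝ ∞ ζ) (hζc : HasCompactSupport ζ) (z : EuclideanSpace ℝ (Fin d)) :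
    HasFDerivAt (smear μ b t ζ)
      (∑ l, smear μ (fun x => b x * (t x)⁻¹) t (pderiv' l ζ) z •
        (EuclideanSpace.proj l : EuclideanSpace ℝ (Fin d) →L[ℝ] ℝ)) z := by
  have hb' : Measurable fun x => b x * (t x)⁻¹ := hb.mul ht.inv
  have hbB' : ∀ x, |b x * (t x)⁻¹| ≤ B * δ⁻¹ := by
    intro x
    have htx : 0 < t x := hδ.trans_le (htδ x)
    have hB : 0 ≤ B := (abs_nonneg _).trans (hbB x)
    rw [abs_mul, abs_of_pos (inv_pos.2 htx)]
    gcongr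
    · exact hbB x
    · exact htδ x
  choose M hM0 hM using fun l : Fin d => exists_abs_le_of_hasCompactSupport
    (contDiff_pderiv' hζ l).continuous (hζc.pderiv' l)
  let F' : EuclideanSpace ℝ (Fin d) → EuclideanSpace ℝ (Fin d) →
      (EuclideanSpace ℝ (Fin d) →L[ℝ] ℝ) := fun z x =>
    ∑ l, ((b x * (t x)⁻¹) * ((t x)⁻¹ ^ d * pderiv' l ζ ((t x)⁻¹ • (z - x)))) •
        (EuclideanSpace.proj l : EuclideanSpace ℝ (Fin d) →L[ℝ] ℝ)
  have hiF : ∀ z l, Integrable (fun x =>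
      (b x * (t x)⁻¹) * ((t x)⁻¹ ^ d * pderiv' l ζ ((t x)⁻¹ • (z - x)))) μ := fun z l =>
    integrable_smear_kernel hb' hbB' ht hδ htδ (contDiff_pderiv' hζ l).continuous (hζc.pderiv' l) z
  have hiF' : ∀ z, Integrable (F' z) μ := fun z =>
    integrable_sum_smul_const (hiF z) _
  have key : HasFDerivAt (fun z => ∫ x, b x * ((t x)⁻¹ ^ d * ζ ((t x)⁻¹ • (z - x))) ∂μ)
      (∫ x, F' z x ∂μ) z := by
    refine hasFDerivAt_integral_of_dominated_of_fderiv_le (s := Set.univ) (F' := F')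
      (bound := fun _ => ∑ l, B * δ⁻¹ * (δ⁻¹ ^ d * M l) *
        ‖(EuclideanSpace.proj l : EuclideanSpace ℝ (Fin d) →L[ℝ] ℝ)‖)
      univ_mem ?_ ?_ ?_ ?_ ?_ ?_
    · exact Eventually.of_forall fun z =>
        (integrable_smear_kernel hb hbB ht hδ htδ hζ.continuous hζc z).aestronglyMeasurable
    · exact integrable_smear_kernel hb hbB ht hδ htδ hζ.continuous hζc z
    · exact (hiF' z).aestronglyMeasurable
    · refine Eventually.of_forall fun x y _ => (norm_sum_le _ _).trans ?_
      gcongr with l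
      rw [norm_smul]
      gcongr
      exact abs_smear_kernel_le hbB' hδ htδ (hM l) x y
    · exact integrable_const _
    · refine Eventually.of_forall fun x y _ => ?_
      have h1 : HasFDerivAt (fun y => (t x)⁻¹ • (y - x))
          ((t x)⁻¹ • ContinuousLinearMap.id ℝ (EuclideanSpace ℝ (Fin d))) y :=
        ((hasFDerivAt_id y).sub_const x).const_smul (t x)⁻¹
      have h2 := ((hζ.differentiable (by simp) ((t x)⁻¹ • (y - x))).hasFDerivAt.comp y
        h1).const_mul ((t x)⁻¹ ^ d) |>.const_mul (b x)
      refine h2.congr_fderiv ?_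
      ext v
      simp only [F', smul_apply, ContinuousLinearMap.comp_apply,
        sum_apply, ContinuousLinearMap.id_apply, map_smul, smul_eq_mul,
        fderiv_apply_eq_sum, Finset.mul_sum, PiLp.proj_apply]
      exact Finset.sum_congr rfl fun l _ => by ring
  refine key.congr_fderiv ?_
  exact integral_sum_smul_const (hiF z) _

theorem pderiv'_smear {μ : Measure (EuclideanSpace ℝ (Fin d))} [IsFiniteMeasure μ]
    {b t ζ : EuclideanSpace ℝ (Fin d) → ℝ} {B δ : ℝ} (hb : Measurable b)
    (hbB : ∀ x, |b x| ≤ B) (ht : Measurable t) (hδ : 0 < δ) (htδ : ∀ x, δ ≤ t x)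
    (hζ : ContDiff ℝ ∞ ζ) (hζc : HasCompactSupport ζ) (l : Fin d)
    (z : EuclideanSpace ℝ (Fin d)) :
    pderiv' l (smear μ b t ζ) z = smear μ (fun x => b x * (t x)⁻¹) t (pderiv' l ζ) z := by
  rw [pderiv', (hasFDerivAt_smear hb hbB ht hδ htδ hζ hζc z).fderiv]
  simp

theorem contDiff_smear {μ : Measure (EuclideanSpace ℝ (Fin d))} [IsFiniteMeasure μ]
    {b t ζ : EuclideanSpace ℝ (Fin d) → ℝ} {B δ : ℝ} (hb : Measurable b)
    (hbB : ∀ x, |b x| ≤ B) (ht : Measurable t) (hδ : 0 < δ) (htδ : ∀ x, δ ≤ t x)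
    (hζ : ContDiff ℝ ∞ ζ) (hζc : HasCompactSupport ζ) : ContDiff ℝ ∞ (smear μ b t ζ) := by
  rw [contDiff_infty]
  intro n
  induction n generalizing b ζ B with
  | zero =>
    exact contDiff_zero.2 (continuous_iff_continuousAt.2 fun z =>
      (hasFDerivAt_smear hb hbB ht hδ htδ hζ hζc z).continuousAt)
  | succ n ih =>
    have hD := hasFDerivAt_smear (μ := μ) hb hbB ht hδ htδ hζ hζc
    have hbB' : ∀ x, |b x * (t x)⁻¹| ≤ B * δ⁻¹ := by
      intro x
      have htx : 0 < t x := hδ.trans_le (htδ x)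
      have hB : 0 ≤ B := (abs_nonneg _).trans (hbB x)
      rw [abs_mul, abs_of_pos (inv_pos.2 htx)]
      gcongr
      · exact hbB x
      · exact htδ x
    push_cast
    rw [contDiff_succ_iff_fderiv]
    refine ⟨fun z => (hD z).differentiableAt, by simp, ?_⟩
    rw [show fderiv ℝ (smear μ b t ζ) = _ from funext fun z => (hD z).fderiv]
    exact ContDiff.sum fun l _ =>
      (ih (hb.mul ht.inv) hbB' (contDiff_pderiv' hζ l) (hζc.pderiv' l)).smul contDiff_const

end Smear

section Kernel

variable {d : ℕ}

/-- The product of a function with the `l`-th coordinate. -/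
def coordMul (l : Fin d) (η : EuclideanSpace ℝ (Fin d) → ℝ) : EuclideanSpace ℝ (Fin d) → ℝ :=
  fun y => y l * η y

theorem contDiff_coordMul {η : EuclideanSpace ℝ (Fin d) → ℝ} (hη : ContDiff ℝ ∞ η) (l : Fin d) :
    ContDiff ℝ ∞ (coordMul l η) :=
  (EuclideanSpace.proj l : EuclideanSpace ℝ (Fin d) →L[ℝ] ℝ).contDiff.mul hη

theorem HasCompactSupport.coordMul {η : EuclideanSpace ℝ (Fin d) → ℝ}
    (hη : HasCompactSupport η) (l : Fin d) : HasCompactSupport (coordMul l η) :=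
  hη.mul_left

theorem pderiv'_coordMul {η : EuclideanSpace ℝ (Fin d) → ℝ} (hη : ContDiff ℝ ∞ η) (l : Fin d)
    (y : EuclideanSpace ℝ (Fin d)) :
    pderiv' l (coordMul l η) y = η y + y l * pderiv' l η y := by
  have h := (EuclideanSpace.proj l : EuclideanSpace ℝ (Fin d) →L[ℝ] ℝ).hasFDerivAt.mul
    (hη.differentiable (by simp) y).hasFDerivAt (x := y)
  have h' : HasFDerivAt (coordMul l η) _ y := h
  rw [pderiv', h'.fderiv]
  simp [pderiv']
  ring

theorem contDiff_kernel {t η : EuclideanSpace ℝ (Fin d) → ℝ} (ht : ContDiff ℝ ∞ t)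
    (htpos : ∀ x, 0 < t x) (hη : ContDiff ℝ ∞ η) (z : EuclideanSpace ℝ (Fin d)) :
    ContDiff ℝ ∞ fun x => (t x)⁻¹ ^ d * η ((t x)⁻¹ • (z - x)) := by
  have hs : ContDiff ℝ ∞ fun x => (t x)⁻¹ := ht.inv fun x => (htpos x).ne'
  exact (hs.pow d).mul (hη.comp (hs.smul (contDiff_const.sub contDiff_id)))

theorem pderiv'_kernel {t η : EuclideanSpace ℝ (Fin d) → ℝ} (ht : ContDiff ℝ ∞ t)
    (htpos : ∀ x, 0 < t x) (hη : ContDiff ℝ ∞ η) (z x : EuclideanSpace ℝ (Fin d)) (k : Fin d) :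
    pderiv' k (fun x => (t x)⁻¹ ^ d * η ((t x)⁻¹ • (z - x))) x =
      -((t x)⁻¹ * ((t x)⁻¹ ^ d * pderiv' k η ((t x)⁻¹ • (z - x)))
        + ∑ l, (pderiv' k t x * (t x)⁻¹) *
          ((t x)⁻¹ ^ d * pderiv' l (coordMul l η) ((t x)⁻¹ • (z - x)))) := by
  have hx := htpos x
  have h1 : HasFDerivAt t (fderiv ℝ t x) x := (ht.differentiable (by simp) x).hasFDerivAt
  have h2 : HasFDerivAt (fun x => (t x)⁻¹) (-((t x) ^ 2)⁻¹ • fderiv ℝ t x) x :=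
    (hasDerivAt_inv hx.ne').comp_hasFDerivAt x h1
  have h3 := h2.pow d
  have h4 := h2.smul ((hasFDerivAt_id x).const_sub z)
  have h5 := (hη.differentiable (by simp) ((t x)⁻¹ • (z - id x))).hasFDerivAt.comp x h4
  have h6 := h3.mul h5
  have h7 : HasFDerivAt (fun x => (t x)⁻¹ ^ d * η ((t x)⁻¹ • (z - x))) _ x := h6
  rw [pderiv', h7.fderiv]
  simp only [pderiv'_coordMul hη]
  simp only [add_apply, smul_apply, ContinuousLinearMap.comp_apply,
    fderiv_apply_eq_sum η, ContinuousLinearMap.smulRight_apply, neg_apply,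
    ContinuousLinearMap.id_apply, id, smul_eq_mul, Function.comp_def]
  have hη0 : η (((fun x => (t x)⁻¹) • fun x => z - x) x) = η ((t x)⁻¹ • (z - x)) := rfl
  have hp : fderiv ℝ t x (EuclideanSpace.single k 1) = pderiv' k t x := rfl
  have hs2 : (t x ^ 2)⁻¹ = (t x)⁻¹ * (t x)⁻¹ := by rw [sq, mul_inv]
  rw [hη0, hp, hs2]
  generalize (t x)⁻¹ = s
  generalize pderiv' k t x = p
  have hd : (d • s ^ (d - 1)) * s = d * s ^ d := by
    rcases Nat.eq_zero_or_pos d with h | h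
    · subst h; simp
    · rw [nsmul_eq_mul, mul_assoc, ← pow_succ, Nat.sub_add_cancel h]
  have e1 : ∑ l, (s • -EuclideanSpace.single k (1 : ℝ) + (-(s * s) * p) • (z - x)).ofLp l
        * pderiv' l η (s • (z - x))
      = -(s * pderiv' k η (s • (z - x)))
        - s * p * ∑ l, (s • (z - x)).ofLp l * pderiv' l η (s • (z - x)) := by
    have : ∀ l, (s • -EuclideanSpace.single k (1 : ℝ) + (-(s * s) * p) • (z - x)).ofLp l
        * pderiv' l η (s • (z - x)) = -(if l = k then s * pderiv' l η (s • (z - x)) else 0)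
          - s * p * ((s • (z - x)).ofLp l * pderiv' l η (s • (z - x))) := by
      intro l
      by_cases h : l = k <;> simp [h] <;> ring
    simp_rw [this]
    rw [Finset.sum_sub_distrib, Finset.sum_neg_distrib, ← Finset.mul_sum]
    simp
  have e2 : ∑ l, p * s * (s ^ d * (η (s • (z - x))
        + (s • (z - x)).ofLp l * pderiv' l η (s • (z - x))))
      = p * s * s ^ d * (d * η (s • (z - x))
        + ∑ l, (s • (z - x)).ofLp l * pderiv' l η (s • (z - x))) := by
    rw [← Finset.mul_sum, ← Finset.mul_sum, Finset.sum_add_distrib]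
    simp
    ring
  rw [e1, e2]
  linear_combination (-(s * p) * η (s • (z - x))) * hd

/-- The partial gradient of `ν` is the divergence of the matrix of measures `q τ`, in the sense of
distributions on the unit ball. -/
def GradEqDiv (ν τ : Measure (EuclideanSpace ℝ (Fin d)))
    (q : Fin d → Fin d → EuclideanSpace ℝ (Fin d) → ℝ) : Prop :=
  ∀ φ : EuclideanSpace ℝ (Fin d) → ℝ, ContDiff ℝ ∞ φ → HasCompactSupport φ →
    tsupport φ ⊆ ball 0 1 → ∀ k, ∫ x, pderiv' k φ x ∂ν = ∑ l, ∫ x, pderiv' l φ x * q k l x ∂τ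

/-- The matrix field whose divergence is the gradient of the mollification of `ν` at scale `t`. -/
noncomputable def smearField (ν τ : Measure (EuclideanSpace ℝ (Fin d)))
    (q : Fin d → Fin d → EuclideanSpace ℝ (Fin d) → ℝ) (t η : EuclideanSpace ℝ (Fin d) → ℝ)
    (k l : Fin d) (z : EuclideanSpace ℝ (Fin d)) : ℝ :=
  smear τ (q k l) t η z + smear τ (fun x => ∑ j, q k j x * pderiv' j t x) t (coordMul l η) z
    - smear ν (pderiv' k t) t (coordMul l η) z

theorem abs_pderiv'_le {t : EuclideanSpace ℝ (Fin d) → ℝ} {κ : ℝ}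
    (hκ : ∀ x, ‖fderiv ℝ t x‖ ≤ κ) (k : Fin d) (x : EuclideanSpace ℝ (Fin d)) :
    |pderiv' k t x| ≤ κ := by
  have := (fderiv ℝ t x).le_of_opNorm_le (hκ x) (EuclideanSpace.single k 1)
  simpa [pderiv'] using this

variable {ν τ : Measure (EuclideanSpace ℝ (Fin d))} [IsFiniteMeasure ν] [IsFiniteMeasure τ]
  {q : Fin d → Fin d → EuclideanSpace ℝ (Fin d) → ℝ} {t η : EuclideanSpace ℝ (Fin d) → ℝ}
  {κ δ T : ℝ}

theorem abs_sum_mul_pderiv'_le (hq1 : ∀ k l x, |q k l x| ≤ 1)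
    (hκ : ∀ x, ‖fderiv ℝ t x‖ ≤ κ) (k : Fin d) (x : EuclideanSpace ℝ (Fin d)) :
    |∑ j, q k j x * pderiv' j t x| ≤ d * κ := by
  refine (Finset.abs_sum_le_sum_abs _ _).trans ?_
  have : ∀ j ∈ Finset.univ, |q k j x * pderiv' j t x| ≤ κ := fun j _ => by
    rw [abs_mul]
    exact (mul_le_of_le_one_left (abs_nonneg _) (hq1 k j x)).trans (abs_pderiv'_le hκ j x)
  simpa using Finset.sum_le_sum this

theorem contDiff_smearField (hq : ∀ k l, Measurable (q k l)) (hq1 : ∀ k l x, |q k l x| ≤ 1)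
    (ht : ContDiff ℝ ∞ t) (hδ : 0 < δ) (htδ : ∀ x, δ ≤ t x) (hκ : ∀ x, ‖fderiv ℝ t x‖ ≤ κ)
    (hη : ContDiff ℝ ∞ η) (hηc : HasCompactSupport η) (k l : Fin d) :
    ContDiff ℝ ∞ (smearField ν τ q t η k l) := by
  have htm := ht.continuous.measurable
  have hm : ∀ j, Measurable (pderiv' j t) := fun j => (contDiff_pderiv' ht j).continuous.measurable
  exact ((contDiff_smear (hq k l) (hq1 k l) htm hδ htδ hη hηc).add
    (contDiff_smear (Finset.measurable_fun_sum _ fun j _ => (hq k j).mul (hm j))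
      (abs_sum_mul_pderiv'_le hq1 hκ k) htm hδ htδ (contDiff_coordMul hη l) (hηc.coordMul l))).sub
    (contDiff_smear (hm k) (abs_pderiv'_le hκ k) htm hδ htδ (contDiff_coordMul hη l)
      (hηc.coordMul l))

theorem pderiv'_smear_eq_sum_pderiv'_smearField (hνq : GradEqDiv ν τ q)
    (hq : ∀ k l, Measurable (q k l)) (hq1 : ∀ k l x, |q k l x| ≤ 1)
    (ht : ContDiff ℝ ∞ t) (hδ : 0 < δ) (htδ : ∀ x, δ ≤ t x) (htT : ∀ x, t x ≤ T)
    (hκ : ∀ x, ‖fderiv ℝ t x‖ ≤ κ) (hη : ContDiff ℝ ∞ η)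
    (hη1 : ∀ y, 1 < ‖y‖ → η y = 0) (k : Fin d) {z : EuclideanSpace ℝ (Fin d)}
    (hz : ‖z‖ + T < 1) :
    pderiv' k (smear ν (fun _ => 1) t η) z = ∑ l, pderiv' l (smearField ν τ q t η k l) z := by
  have hηc : HasCompactSupport η :=
    HasCompactSupport.of_support_subset_isCompact (isCompact_closedBall 0 1) fun y hy => by
      by_contra h
      exact hy (hη1 y (by simpa using h))
  have htpos : ∀ x, 0 < t x := fun x => hδ.trans_le (htδ x)
  have htm := ht.continuous.measurable
  have hm : ∀ j, Measurable (pderiv' j t) := fun j => (contDiff_pderiv' ht j).continuous.measurable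
  have hφ := contDiff_kernel ht htpos hη z
  have hsupp : Function.support (fun x => (t x)⁻¹ ^ d * η ((t x)⁻¹ • (z - x)))
      ⊆ closedBall z T := by
    intro x hx
    by_contra h
    rw [mem_closedBall, not_le, dist_comm, dist_eq_norm] at h
    refine hx ?_
    have : 1 < ‖(t x)⁻¹ • (z - x)‖ := by
      rw [norm_smul, norm_inv, Real.norm_of_nonneg (htpos x).le, ← div_eq_inv_mul,
        one_lt_div (htpos x)]
      exact (htT x).trans_lt h
    simp [hη1 _ this]
  have hφc : HasCompactSupport (fun x => (t x)⁻¹ ^ d * η ((t x)⁻¹ • (z - x))) :=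
    HasCompactSupport.of_support_subset_isCompact (isCompact_closedBall z T) hsupp
  have hts : tsupport (fun x => (t x)⁻¹ ^ d * η ((t x)⁻¹ • (z - x))) ⊆ ball 0 1 :=
    (closure_minimal hsupp isClosed_closedBall).trans
      (closedBall_subset_ball' (by rw [dist_zero_right]; linarith))
  have key := hνq _ hφ hφc hts k
  simp only [pderiv'_kernel ht htpos hη] at key
  have hψ : ∀ l, ContDiff ℝ ∞ (coordMul l η) := contDiff_coordMul hη
  have hψc : ∀ l, HasCompactSupport (coordMul l η) := hηc.coordMul
  have hinv : ∀ {b : EuclideanSpace ℝ (Fin d) → ℝ} {B : ℝ}, (∀ x, |b x| ≤ B) →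
      ∀ x, |b x * (t x)⁻¹| ≤ B * δ⁻¹ := fun {b B} hb x => by
    have hB : 0 ≤ B := (abs_nonneg _).trans (hb x)
    have hx := htpos x
    rw [abs_mul, abs_of_pos (inv_pos.2 hx)]
    gcongr
    · exact hb x
    · exact htδ x
  have hqt : ∀ j x, |q k j x * pderiv' j t x| ≤ κ := fun j x => by
    rw [abs_mul]
    exact (mul_le_of_le_one_left (abs_nonneg _) (hq1 k j x)).trans (abs_pderiv'_le hκ j x)
  have hi : ∀ (μ : Measure (EuclideanSpace ℝ (Fin d))) [IsFiniteMeasure μ]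
      {b ζ : EuclideanSpace ℝ (Fin d) → ℝ} {B : ℝ}, Measurable b → (∀ x, |b x| ≤ B) →
      ContDiff ℝ ∞ ζ → HasCompactSupport ζ → ∀ l, Integrable (fun x => (b x * (t x)⁻¹) *
        ((t x)⁻¹ ^ d * pderiv' l ζ ((t x)⁻¹ • (z - x)))) μ :=
    fun μ _ b ζ B hb hbB hζ hζc l => integrable_smear_kernel (hb.mul htm.inv) (hinv hbB) htm hδ htδ
      (contDiff_pderiv' hζ l).continuous (hζc.pderiv' l) z
  have hiν := hi ν (measurable_const (a := (1 : ℝ))) (B := 1) (by simp) hη hηc k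
  have hiν' := fun l => hi ν (hm k) (abs_pderiv'_le hκ k) (hψ l) (hψc l) l
  have hiτ := fun l => hi τ (hq k l) (hq1 k l) hη hηc l
  have hqm : ∀ j, Measurable fun x => q k j x * pderiv' j t x := fun j => (hq k j).mul (hm j)
  have hsm : Measurable fun x => ∑ j, q k j x * pderiv' j t x :=
    Finset.measurable_fun_sum _ fun j _ => hqm j
  have hiτ' := fun j l => hi τ (hqm j) (hqt j) (hψ l) (hψc l) l
  have eν : ∫ x, -((t x)⁻¹ * ((t x)⁻¹ ^ d * pderiv' k η ((t x)⁻¹ • (z - x)))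
        + ∑ l, (pderiv' k t x * (t x)⁻¹) *
          ((t x)⁻¹ ^ d * pderiv' l (coordMul l η) ((t x)⁻¹ • (z - x)))) ∂ν
      = -(pderiv' k (smear ν (fun _ => 1) t η) z
        + ∑ l, pderiv' l (smear ν (pderiv' k t) t (coordMul l η)) z) := by
    rw [integral_neg, integral_add (by simpa using hiν) (integrable_finsetSum _ fun l _ => hiν' l),
      integral_finsetSum _ fun l _ => hiν' l,
      pderiv'_smear measurable_const (B := 1) (by simp) htm hδ htδ hη hηc]
    simp only [pderiv'_smear (hm k) (abs_pderiv'_le hκ k) htm hδ htδ (hψ _) (hψc _), one_mul]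
    rfl
  have eτ : ∀ l, ∫ x, -((t x)⁻¹ * ((t x)⁻¹ ^ d * pderiv' l η ((t x)⁻¹ • (z - x)))
        + ∑ j, (pderiv' l t x * (t x)⁻¹) *
          ((t x)⁻¹ ^ d * pderiv' j (coordMul j η) ((t x)⁻¹ • (z - x)))) * q k l x ∂τ
      = -(pderiv' l (smear τ (q k l) t η) z
        + ∑ j, smear τ (fun x => q k l x * pderiv' l t x * (t x)⁻¹) t
          (pderiv' j (coordMul j η)) z) := by
    intro l
    have h1 : ∀ x, -((t x)⁻¹ * ((t x)⁻¹ ^ d * pderiv' l η ((t x)⁻¹ • (z - x)))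
        + ∑ j, (pderiv' l t x * (t x)⁻¹) *
          ((t x)⁻¹ ^ d * pderiv' j (coordMul j η) ((t x)⁻¹ • (z - x)))) * q k l x
        = -((q k l x * (t x)⁻¹) * ((t x)⁻¹ ^ d * pderiv' l η ((t x)⁻¹ • (z - x)))
          + ∑ j, (q k l x * pderiv' l t x * (t x)⁻¹) *
            ((t x)⁻¹ ^ d * pderiv' j (coordMul j η) ((t x)⁻¹ • (z - x)))) := by
      intro x
      simp only [mul_assoc, ← Finset.mul_sum]
      ring
    simp_rw [h1]
    rw [integral_neg, integral_add (hiτ l) (integrable_finsetSum _ fun j _ => hiτ' l j),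
      integral_finsetSum _ fun j _ => hiτ' l j,
      pderiv'_smear (hq k l) (hq1 k l) htm hδ htδ hη hηc]
    rfl
  have eq : ∀ j, pderiv' j (smear τ (fun x => ∑ l, q k l x * pderiv' l t x) t (coordMul j η)) z
      = ∑ l, smear τ (fun x => q k l x * pderiv' l t x * (t x)⁻¹) t
          (pderiv' j (coordMul j η)) z := by
    intro j
    rw [pderiv'_smear hsm (abs_sum_mul_pderiv'_le hq1 hκ k) htm hδ htδ (hψ j) (hψc j)]
    simp only [smear]
    rw [← integral_finsetSum _ fun l _ => hiτ' l j]
    simp only [Finset.sum_mul]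
  have eW : ∀ l, pderiv' l (smearField ν τ q t η k l) z
      = pderiv' l (smear τ (q k l) t η) z
        + pderiv' l (smear τ (fun x => ∑ j, q k j x * pderiv' j t x) t (coordMul l η)) z
        - pderiv' l (smear ν (pderiv' k t) t (coordMul l η)) z := by
    intro l
    have h1 := hasFDerivAt_smear (μ := τ) (hq k l) (hq1 k l) htm hδ htδ hη hηc z
    have h2 := hasFDerivAt_smear (μ := τ) hsm
      (abs_sum_mul_pderiv'_le hq1 hκ k) htm hδ htδ (hψ l) (hψc l) z
    have h3 := hasFDerivAt_smear (μ := ν) (hm k) (abs_pderiv'_le hκ k) htm hδ htδ (hψ l) (hψc l) z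
    have h : HasFDerivAt (smearField ν τ q t η k l) _ z := (h1.add h2).sub h3
    simp only [pderiv']
    rw [h.fderiv, ← h1.fderiv, ← h2.fderiv, ← h3.fderiv]
    rfl
  rw [eν, Finset.sum_congr rfl fun l _ => eτ l] at key
  simp only [eW, eq, Finset.sum_sub_distrib, Finset.sum_add_distrib, Finset.sum_neg_distrib]
    at key ⊢
  rw [Finset.sum_comm] at key
  linarith

end Kernel

section Bounds

variable {d : ℕ} {t η : EuclideanSpace ℝ (Fin d) → ℝ} {δ : ℝ}

theorem hasCompactSupport_of_eq_zero_of_one_lt_norm {η : EuclideanSpace ℝ (Fin d) → ℝ}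
    (hη1 : ∀ y, 1 < ‖y‖ → η y = 0) : HasCompactSupport η :=
  HasCompactSupport.of_support_subset_isCompact (isCompact_closedBall 0 1) fun y hy => by
    by_contra h
    exact hy (hη1 y (by simpa using h))

theorem kernel_eq_zero (htpos : ∀ x, 0 < t x) (hη1 : ∀ y, 1 < ‖y‖ → η y = 0)
    {x z : EuclideanSpace ℝ (Fin d)} (h : t x < dist z x) : η ((t x)⁻¹ • (z - x)) = 0 := by
  refine hη1 _ ?_
  rwa [norm_smul, norm_inv, Real.norm_of_nonneg (htpos x).le, ← div_eq_inv_mul,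
    one_lt_div (htpos x), ← dist_eq_norm]

theorem smear_nonneg {μ : Measure (EuclideanSpace ℝ (Fin d))} (htpos : ∀ x, 0 < t x)
    (hη0 : ∀ y, 0 ≤ η y) (z : EuclideanSpace ℝ (Fin d)) : 0 ≤ smear μ (fun _ => 1) t η z :=
  integral_nonneg fun x => by
    have := htpos x
    have := hη0 ((t x)⁻¹ • (z - x))
    positivity

theorem abs_smear_le {μ : Measure (EuclideanSpace ℝ (Fin d))} [IsFiniteMeasure μ]
    {b ζ : EuclideanSpace ℝ (Fin d) → ℝ} {B : ℝ}
    (hbB : ∀ x, |b x| ≤ B) (ht : Measurable t) (hδ : 0 < δ) (htδ : ∀ x, δ ≤ t x)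
    (hη : Continuous η) (hηc : HasCompactSupport η) (hζη : ∀ y, |ζ y| ≤ η y)
    (z : EuclideanSpace ℝ (Fin d)) :
    |smear μ b t ζ z| ≤ B * smear μ (fun _ => 1) t η z := by
  rw [smear, smear, ← integral_const_mul]
  refine norm_integral_le_of_norm_le (f := fun x => b x * ((t x)⁻¹ ^ d * ζ ((t x)⁻¹ • (z - x))))
    ((integrable_smear_kernel measurable_const (B := 1) (by simp) ht hδ htδ hη hηc z).const_mul B)
    (Eventually.of_forall fun x => ?_)
  have hx : 0 < t x := hδ.trans_le (htδ x)
  have hB : 0 ≤ B := (abs_nonneg _).trans (hbB x)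
  rw [Real.norm_eq_abs, abs_mul, abs_mul, abs_of_pos (pow_pos (inv_pos.2 hx) d), one_mul]
  gcongr
  · exact hbB x
  · exact hζη _

theorem abs_coordMul_le (hη0 : ∀ y, 0 ≤ η y) (hη1 : ∀ y, 1 < ‖y‖ → η y = 0) (l : Fin d)
    (y : EuclideanSpace ℝ (Fin d)) : |coordMul l η y| ≤ η y := by
  rw [coordMul, abs_mul, abs_of_nonneg (hη0 y)]
  by_cases h : 1 < ‖y‖
  · simp [hη1 y h]
  · exact mul_le_of_le_one_left (hη0 y) ((PiLp.norm_apply_le y l).trans (not_lt.1 h))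

theorem abs_smearField_le {ν τ : Measure (EuclideanSpace ℝ (Fin d))} [IsFiniteMeasure ν]
    [IsFiniteMeasure τ] {q : Fin d → Fin d → EuclideanSpace ℝ (Fin d) → ℝ} {κ : ℝ}
    (hq1 : ∀ k l x, |q k l x| ≤ 1)
    (ht : ContDiff ℝ ∞ t) (hδ : 0 < δ) (htδ : ∀ x, δ ≤ t x) (hκ : ∀ x, ‖fderiv ℝ t x‖ ≤ κ)
    (hη : Continuous η) (hη0 : ∀ y, 0 ≤ η y) (hη1 : ∀ y, 1 < ‖y‖ → η y = 0) (k l : Fin d)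
    (z : EuclideanSpace ℝ (Fin d)) :
    |smearField ν τ q t η k l z|
      ≤ (1 + d * κ) * smear τ (fun _ => 1) t η z + κ * smear ν (fun _ => 1) t η z := by
  have htm := ht.continuous.measurable
  have hηc := hasCompactSupport_of_eq_zero_of_one_lt_norm hη1
  have h1 := abs_smear_le (μ := τ) (hq1 k l) htm hδ htδ hη hηc
    (fun y => (abs_of_nonneg (hη0 y)).le) z
  have h2 := abs_smear_le (μ := τ) (abs_sum_mul_pderiv'_le hq1 hκ k) htm hδ htδ hη hηc
    (abs_coordMul_le hη0 hη1 l) z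
  have h3 := abs_smear_le (μ := ν) (abs_pderiv'_le hκ k) htm hδ htδ hη hηc
    (abs_coordMul_le hη0 hη1 l) z
  rw [smearField]
  refine (abs_sub _ _).trans ((add_le_add (abs_add_le _ _) le_rfl).trans ?_)
  linarith

theorem smear_one_le {τ : Measure (EuclideanSpace ℝ (Fin d))} [IsFiniteMeasure τ] {κ M : ℝ}
    (htL : ∀ x y, |t x - t y| ≤ κ * dist x y) (hκ : κ ≤ 1 / 2)
    (htpos : ∀ x, 0 < t x) (hη0 : ∀ y, 0 ≤ η y) (hη1 : ∀ y, 1 < ‖y‖ → η y = 0)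
    (hM : ∀ y, η y ≤ M) (z : EuclideanSpace ℝ (Fin d)) :
    smear τ (fun _ => 1) t η z
      ≤ (3 / 2 * (t z)⁻¹) ^ d * M * τ.real (closedBall z (2 * t z)) := by
  have hM0 : 0 ≤ M := (hη0 0).trans (hM 0)
  have hz := htpos z
  have h1 : ∫ x, (closedBall z (2 * t z)).indicator (fun _ => (3 / 2 * (t z)⁻¹) ^ d * M) x ∂τ
      = (3 / 2 * (t z)⁻¹) ^ d * M * τ.real (closedBall z (2 * t z)) := by
    rw [integral_indicator measurableSet_closedBall, setIntegral_const, smul_eq_mul, mul_comm]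
  rw [← h1]
  refine integral_mono_of_nonneg (Eventually.of_forall fun x => ?_)
    ((integrable_const _).indicator measurableSet_closedBall) (Eventually.of_forall fun x => ?_)
  · have := htpos x
    have := hη0 ((t x)⁻¹ • (z - x))
    simp only [Pi.zero_apply]
    positivity
  · simp only [one_mul]
    have hx := htpos x
    by_cases h : t x < dist z x
    · rw [kernel_eq_zero htpos hη1 h, mul_zero]
      exact Set.indicator_nonneg (fun _ _ => by positivity) _
    · rw [not_lt] at h
      have h2 : |t x - t z| ≤ 1 / 2 * t x := (htL x z).trans (by
        rw [dist_comm]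
        exact mul_le_mul hκ h dist_nonneg (by norm_num))
      rw [abs_le] at h2
      have hmem : x ∈ closedBall z (2 * t z) := by
        rw [mem_closedBall, dist_comm]; linarith
      rw [Set.indicator_of_mem hmem]
      have h3 : (t x)⁻¹ ≤ 3 / 2 * (t z)⁻¹ := by
        rw [← inv_inv (3 / 2 : ℝ), ← mul_inv]
        exact inv_anti₀ (by positivity) (by linarith)
      have h4 := hη0 ((t x)⁻¹ • (z - x))
      gcongr
      exact hM _

theorem integral_kernel (htpos : ∀ x, 0 < t x) (x : EuclideanSpace ℝ (Fin d)) :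
    ∫ z, (t x)⁻¹ ^ d * η ((t x)⁻¹ • (z - x)) = ∫ y, η y := by
  have hx := htpos x
  rw [integral_const_mul, integral_sub_right_eq_self (fun z => η ((t x)⁻¹ • z)) x,
    Measure.integral_comp_smul, finrank_euclideanSpace_fin, abs_of_pos (by positivity),
    smul_eq_mul, ← mul_assoc, mul_inv_cancel₀ (by positivity), one_mul]

theorem setIntegral_smear {ν : Measure (EuclideanSpace ℝ (Fin d))} [IsFiniteMeasure ν]
    (ht : Measurable t) (hδ : 0 < δ) (htδ : ∀ x, δ ≤ t x)
    (hη : Continuous η) (hηc : HasCompactSupport η) {G : Set (EuclideanSpace ℝ (Fin d))}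
    (hG : volume G ≠ ⊤) :
    ∫ z in G, smear ν (fun _ => 1) t η z
      = ∫ x, (∫ z in G, (t x)⁻¹ ^ d * η ((t x)⁻¹ • (z - x))) ∂ν := by
  have : IsFiniteMeasure (volume.restrict G) := ⟨by simpa using hG.lt_top⟩
  obtain ⟨M, -, hM⟩ := exists_abs_le_of_hasCompactSupport hη hηc
  have hi := Integrable.of_bound (μ := (volume.restrict G).prod ν)
    (measurable_smear_kernel measurable_const ht hη).aestronglyMeasurable
    (1 * (δ⁻¹ ^ d * M)) (Eventually.of_forall fun p =>
      abs_smear_kernel_le (b := fun _ => 1) (by simp) hδ htδ hM p.2 p.1)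
  simp only [smear]
  rw [integral_integral_swap hi]
  simp only [one_mul]

theorem integrable_kernel (htpos : ∀ x, 0 < t x) (hη : Continuous η) (hηc : HasCompactSupport η)
    (x : EuclideanSpace ℝ (Fin d)) :
    Integrable fun z => (t x)⁻¹ ^ d * η ((t x)⁻¹ • (z - x)) := by
  refine Integrable.const_mul ?_ _
  exact Integrable.comp_sub_right (f := fun z => η ((t x)⁻¹ • z))
    ((integrable_comp_smul_iff volume η (inv_ne_zero (htpos x).ne')).2
      (hη.integrable_of_hasCompactSupport hηc)) x

theorem setIntegral_kernel_le (htpos : ∀ x, 0 < t x) (hη : Continuous η)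
    (hηc : HasCompactSupport η) (hη0 : ∀ y, 0 ≤ η y) (hηI : ∫ y, η y = 1)
    (G : Set (EuclideanSpace ℝ (Fin d))) (x : EuclideanSpace ℝ (Fin d)) :
    ∫ z in G, (t x)⁻¹ ^ d * η ((t x)⁻¹ • (z - x)) ≤ 1 := by
  rw [← hηI, ← integral_kernel htpos x]
  refine setIntegral_le_integral (integrable_kernel htpos hη hηc x)
    (Eventually.of_forall fun z => ?_)
  have := htpos x
  have := hη0 ((t x)⁻¹ • (z - x))
  simp only [Pi.zero_apply]
  positivity

theorem setIntegral_kernel_nonneg (htpos : ∀ x, 0 < t x) (hη0 : ∀ y, 0 ≤ η y)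
    (G : Set (EuclideanSpace ℝ (Fin d))) (x : EuclideanSpace ℝ (Fin d)) :
    0 ≤ ∫ z in G, (t x)⁻¹ ^ d * η ((t x)⁻¹ • (z - x)) :=
  integral_nonneg fun z => by
    have := htpos x
    have := hη0 ((t x)⁻¹ • (z - x))
    positivity

theorem integrable_setIntegral_kernel {ν : Measure (EuclideanSpace ℝ (Fin d))} [IsFiniteMeasure ν]
    (ht : Measurable t) (hδ : 0 < δ) (htδ : ∀ x, δ ≤ t x)
    (hη : Continuous η) (hηc : HasCompactSupport η) (hη0 : ∀ y, 0 ≤ η y) (hηI : ∫ y, η y = 1)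
    (G : Set (EuclideanSpace ℝ (Fin d))) :
    Integrable (fun x => ∫ z in G, (t x)⁻¹ ^ d * η ((t x)⁻¹ • (z - x))) ν := by
  have htpos : ∀ x, 0 < t x := fun x => hδ.trans_le (htδ x)
  have hm := (measurable_smear_kernel (b := fun _ => 1) measurable_const ht hη).stronglyMeasurable
  simp only [one_mul] at hm
  refine Integrable.of_bound (C := 1) ?_ (Eventually.of_forall fun x => ?_)
  · exact (hm.integral_prod_left (μ := volume.restrict G)).aestronglyMeasurable
  · rw [Real.norm_of_nonneg (setIntegral_kernel_nonneg htpos hη0 G x)]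
    exact setIntegral_kernel_le htpos hη hηc hη0 hηI G x

theorem measureReal_ball_le_setIntegral_smear {ν : Measure (EuclideanSpace ℝ (Fin d))}
    [IsFiniteMeasure ν] {T R R' : ℝ} (ht : Measurable t) (hδ : 0 < δ) (htδ : ∀ x, δ ≤ t x)
    (htT : ∀ x, t x ≤ T) (hη : Continuous η) (hη0 : ∀ y, 0 ≤ η y)
    (hη1 : ∀ y, 1 < ‖y‖ → η y = 0) (hηI : ∫ y, η y = 1) (hR : R + T ≤ R') :
    ν.real (ball 0 R) ≤ ∫ z in ball 0 R', smear ν (fun _ => 1) t η z := by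
  have htpos : ∀ x, 0 < t x := fun x => hδ.trans_le (htδ x)
  have hηc := hasCompactSupport_of_eq_zero_of_one_lt_norm hη1
  rw [setIntegral_smear ht hδ htδ hη hηc measure_ball_lt_top.ne,
    ← integral_indicator_one measurableSet_ball]
  refine integral_mono (μ := ν) ((integrable_const 1).indicator measurableSet_ball)
    (integrable_setIntegral_kernel ht hδ htδ hη hηc hη0 hηI _) fun x => ?_
  by_cases hx : x ∈ ball (0 : EuclideanSpace ℝ (Fin d)) R
  · rw [Set.indicator_of_mem hx, setIntegral_eq_integral_of_forall_compl_eq_zero,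
      integral_kernel htpos, hηI]
    · rfl
    · intro z hz
      rw [kernel_eq_zero htpos hη1, mul_zero]
      rw [mem_ball, dist_zero_right] at hx hz
      have h1 : ‖z‖ ≤ ‖x‖ + dist z x := by
        rw [dist_eq_norm]
        simpa using norm_add_le x (z - x)
      linarith [htT x]
  · rw [Set.indicator_of_notMem hx]
    exact setIntegral_kernel_nonneg htpos hη0 _ x

theorem setIntegral_smear_le {ν : Measure (EuclideanSpace ℝ (Fin d))}
    [IsFiniteMeasure ν] (ht : Measurable t) (hδ : 0 < δ) (htδ : ∀ x, δ ≤ t x)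
    (hη : Continuous η) (hη0 : ∀ y, 0 ≤ η y)
    (hη1 : ∀ y, 1 < ‖y‖ → η y = 0) (hηI : ∫ y, η y = 1)
    {G K : Set (EuclideanSpace ℝ (Fin d))} (hK : MeasurableSet K)
    (hG : volume G ≠ ⊤)
    (hGK : ∀ x ∈ K, ∀ z ∈ G, t x < dist z x) :
    ∫ z in G, smear ν (fun _ => 1) t η z ≤ ν.real Kᶜ := by
  have htpos : ∀ x, 0 < t x := fun x => hδ.trans_le (htδ x)
  have hηc := hasCompactSupport_of_eq_zero_of_one_lt_norm hη1
  rw [setIntegral_smear ht hδ htδ hη hηc hG, ← integral_indicator_one hK.compl]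
  refine integral_mono (μ := ν) (integrable_setIntegral_kernel ht hδ htδ hη hηc hη0 hηI _)
    ((integrable_const 1).indicator hK.compl) fun x => ?_
  by_cases hx : x ∈ K
  · rw [Set.indicator_of_notMem (by simpa using hx)]
    refine (setIntegral_eq_zero_of_forall_eq_zero fun z hz => ?_).le
    rw [kernel_eq_zero htpos hη1 (hGK x hx z hz), mul_zero]
  · rw [Set.indicator_of_mem (by simpa using hx)]
    exact setIntegral_kernel_le htpos hη hηc hη0 hηI G x

end Bounds

section Scale

variable {d : ℕ}

/-- The union of the open balls of radius at most one whose closure has `d`-dimensional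
`τ`-density at least `s`. -/
def denseBalls (τ : Measure (EuclideanSpace ℝ (Fin d))) (s : ℝ) :
    Set (EuclideanSpace ℝ (Fin d)) :=
  ⋃ p ∈ {p : EuclideanSpace ℝ (Fin d) × ℝ | 0 < p.2 ∧ p.2 ≤ 1 ∧
    ENNReal.ofReal (s * p.2 ^ d) ≤ τ (closedBall p.1 p.2)}, ball p.1 p.2

theorem isOpen_denseBalls (τ : Measure (EuclideanSpace ℝ (Fin d))) (s : ℝ) :
    IsOpen (denseBalls τ s) :=
  isOpen_biUnion fun _ _ => isOpen_ball

theorem volume_denseBalls_le (τ : Measure (EuclideanSpace ℝ (Fin d))) {s : ℝ} (hs : 0 < s) :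
    volume (denseBalls τ s) ≤ ENNReal.ofReal (5 ^ d / s) *
      volume (ball (0 : EuclideanSpace ℝ (Fin d)) 1) * τ Set.univ := by
  obtain ⟨u, hu, hdisj, hcov⟩ := Vitali.exists_disjoint_subfamily_covering_enlargement_closedBall
    {p : EuclideanSpace ℝ (Fin d) × ℝ | 0 < p.2 ∧ p.2 ≤ 1 ∧
      ENNReal.ofReal (s * p.2 ^ d) ≤ τ (closedBall p.1 p.2)} Prod.fst Prod.snd 1
    (fun a ha => ha.2.1) 5 (by norm_num)
  have hcount : u.Countable := hdisj.countable_of_nonempty_interior fun p hp =>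
    ⟨p.1, ball_subset_interior_closedBall (mem_ball_self (hu hp).1)⟩
  have hsub : denseBalls τ s ⊆ ⋃ p ∈ u, closedBall p.1 (5 * p.2) := by
    refine Set.iUnion₂_subset fun p hp => ?_
    obtain ⟨q, hq, hpq⟩ := hcov p hp
    exact (ball_subset_closedBall.trans hpq).trans
      (Set.subset_biUnion_of_mem (u := fun q : EuclideanSpace ℝ (Fin d) × ℝ =>
        closedBall q.1 (5 * q.2)) hq)
  have : Countable u := hcount.to_subtype
  calc volume (denseBalls τ s)
      ≤ volume (⋃ p ∈ u, closedBall p.1 (5 * p.2)) := measure_mono hsub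
    _ ≤ ∑' p : u, volume (closedBall p.1.1 (5 * p.1.2)) := measure_biUnion_le _ hcount _
    _ ≤ ∑' p : u, ENNReal.ofReal (5 ^ d / s) *
          volume (ball (0 : EuclideanSpace ℝ (Fin d)) 1) * τ (closedBall p.1.1 p.1.2) := by
        refine ENNReal.tsum_le_tsum fun p => ?_
        have hp := hu p.2
        rw [Measure.addHaar_closedBall _ _ (by linarith [hp.1]), finrank_euclideanSpace_fin]
        calc ENNReal.ofReal ((5 * p.1.2) ^ d) *
              volume (ball (0 : EuclideanSpace ℝ (Fin d)) 1)
            = ENNReal.ofReal (5 ^ d / s) * volume (ball (0 : EuclideanSpace ℝ (Fin d)) 1) *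
              ENNReal.ofReal (s * p.1.2 ^ d) := by
              rw [mul_right_comm, ← ENNReal.ofReal_mul (by positivity)]
              congr 2
              field_simp
              rw [mul_pow]
          _ ≤ _ := by gcongr; exact hp.2.2
    _ = ENNReal.ofReal (5 ^ d / s) * volume (ball (0 : EuclideanSpace ℝ (Fin d)) 1) *
          ∑' p : u, τ (closedBall p.1.1 p.1.2) := ENNReal.tsum_mul_left
    _ ≤ _ := by
        gcongr
        refine tsum_measure_le_measure_univ (fun p => measurableSet_closedBall.nullMeasurableSet) ?_
        intro p q hpq
        exact (hdisj p.2 q.2 fun h => hpq (Subtype.ext h)).aedisjoint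

theorem LipschitzWith.exists_contDiff_lipschitzWith {g : EuclideanSpace ℝ (Fin d) → ℝ}
    {K : NNReal} (hg : LipschitzWith K g) {ε : ℝ} (hε : 0 < ε) :
    ∃ t : EuclideanSpace ℝ (Fin d) → ℝ, ContDiff ℝ ∞ t ∧ LipschitzWith K t ∧
      ∀ a s, (∀ x ∈ ball a ε, dist (g x) (g a) ≤ s) → dist (t a) (g a) ≤ s := by
  let φ : ContDiffBump (0 : EuclideanSpace ℝ (Fin d)) := ⟨ε / 2, ε, half_pos hε, half_lt_self hε⟩
  have hgl : LocallyIntegrable g volume := hg.continuous.locallyIntegrable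
  refine ⟨_, φ.hasCompactSupport_normed.contDiff_convolution_left
    (ContinuousLinearMap.lsmul ℝ ℝ) (φ.contDiff_normed (μ := volume)) hgl, ?_,
    fun a s => φ.dist_normed_convolution_le hgl.aestronglyMeasurable⟩
  refine LipschitzWith.of_dist_le_mul fun x y => ?_
  have hgi : ∀ x, Integrable (fun y => φ.normed volume y • g (x - y)) volume := fun x =>
    (φ.continuous_normed.smul (hg.continuous.comp (by fun_prop))).integrable_of_hasCompactSupport
      φ.hasCompactSupport_normed.smul_right
  have h1 : ∀ x, MeasureTheory.convolution (φ.normed volume) g (ContinuousLinearMap.lsmul ℝ ℝ)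
      volume x = ∫ y, φ.normed volume y • g (x - y) := fun x => rfl
  rw [h1, h1, dist_eq_norm, ← integral_sub (hgi x) (hgi y)]
  calc ‖∫ a, φ.normed volume a • g (x - a) - φ.normed volume a • g (y - a)‖
      ≤ ∫ a, φ.normed volume a * (K * dist x y) := by
        refine norm_integral_le_of_norm_le (φ.integrable_normed.mul_const _)
          (ae_of_all _ fun a => ?_)
        rw [← smul_sub, norm_smul, Real.norm_of_nonneg (φ.nonneg_normed a)]
        refine mul_le_mul_of_nonneg_left ?_ (φ.nonneg_normed a)
        simpa [← dist_eq_norm] using hg.dist_le_mul (x - a) (y - a)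
    _ = K * dist x y := by rw [integral_mul_const, φ.integral_normed, one_mul]

theorem exists_contDiff_scale {κ δ : ℝ} (hκ : 0 < κ) (hκ1 : κ ≤ 1 / 4) (hδ : 0 < δ)
    (hδκ : δ ≤ κ / 10) {F : Set (EuclideanSpace ℝ (Fin d))} (hF : F.Nonempty)
    (hFb : F ⊆ closedBall 0 (3 / 5)) :
    ∃ t : EuclideanSpace ℝ (Fin d) → ℝ, ContDiff ℝ ∞ t ∧ (∀ x, δ / 2 ≤ t x) ∧
      (∀ x, t x ≤ κ / 5) ∧ (∀ x, 3 / 4 ≤ ‖x‖ → t x = κ / 10) ∧ (∀ x, ‖fderiv ℝ t x‖ ≤ κ) ∧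
      (∀ x y, |t x - t y| ≤ κ * dist x y) ∧ (∀ x, t x ≤ 2 * max δ (κ * infDist x F)) ∧
      (∀ x, min (κ / 10) (κ * infDist x F) ≤ 2 * t x) := by
  let K : NNReal := ⟨κ, hκ.le⟩
  have hg : LipschitzWith K fun x => min (κ / 10) (max δ (κ * infDist x F)) := by
    have h1 : LipschitzWith K fun x => κ * infDist x F := by
      refine LipschitzWith.of_dist_le_mul fun x y => ?_
      have := (lipschitz_infDist_pt F).dist_le_mul x y
      rw [Real.dist_eq, ← mul_sub, abs_mul, abs_of_pos hκ]
      rw [Real.dist_eq] at this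
      simp only [NNReal.coe_one, one_mul] at this
      exact mul_le_mul_of_nonneg_left this hκ.le
    exact (h1.const_max δ).const_min (κ / 10)
  obtain ⟨t, ht, htL, htg⟩ := hg.exists_contDiff_lipschitzWith (half_pos hδ)
  have hclose : ∀ x, |t x - min (κ / 10) (max δ (κ * infDist x F))| ≤ δ / 8 := by
    intro x
    refine htg x _ fun y hy => ?_
    have := hg.dist_le_mul y x
    refine this.trans ?_
    have h2 : (K : ℝ) = κ := rfl
    rw [h2]
    have := mem_ball.1 hy
    nlinarith [dist_nonneg (x := y) (y := x)]
  have hg1 : ∀ x, δ ≤ min (κ / 10) (max δ (κ * infDist x F)) := fun x =>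
    le_min hδκ (le_max_left _ _)
  refine ⟨t, ht, fun x => ?_, fun x => ?_, fun x hx => ?_, fun x => ?_, fun x y => ?_,
    fun x => ?_, fun x => ?_⟩
  · linarith [(abs_le.1 (hclose x)).1, hg1 x]
  · linarith [(abs_le.1 (hclose x)).2, min_le_left (κ / 10) (max δ (κ * infDist x F))]
  · have hfar : ∀ y ∈ ball x (δ / 2), min (κ / 10) (max δ (κ * infDist y F)) = κ / 10 := by
      intro y hy
      have h1 : (1 / 10 : ℝ) ≤ infDist y F := by
        refine (le_infDist hF).2 fun w hw => ?_
        have hw' := mem_closedBall_zero_iff.1 (hFb hw)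
        have hy' := mem_ball.1 hy
        have e1 : ‖x‖ ≤ dist y x + dist y w + ‖w‖ := by
          have := dist_triangle4 x y w 0
          rw [dist_zero_right, dist_zero_right, dist_comm x y] at this
          exact this
        linarith
      exact min_eq_left (le_max_of_le_right (by nlinarith))
    have hx' := hfar x (mem_ball_self (half_pos hδ))
    have := htg x 0 fun y hy => by rw [hfar y hy, hx', dist_self]
    rw [hx'] at this
    exact dist_le_zero.1 this
  · exact norm_fderiv_le_of_lipschitz ℝ htL
  · exact htL.dist_le_mul x y
  · linarith [(abs_le.1 (hclose x)).2, min_le_right (κ / 10) (max δ (κ * infDist x F)),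
      le_max_left δ (κ * infDist x F)]
  · have : min (κ / 10) (κ * infDist x F) ≤ min (κ / 10) (max δ (κ * infDist x F)) :=
      min_le_min_left _ (le_max_right _ _)
    linarith [(abs_le.1 (hclose x)).1, hg1 x]

end Scale

section Cutoff

variable {d : ℕ}

theorem exists_mollifier (d : ℕ) : ∃ (η : EuclideanSpace ℝ (Fin d) → ℝ) (M : ℝ), ContDiff ℝ ∞ η ∧
    0 < M ∧ (∀ y, 0 ≤ η y) ∧ (∀ y, η y ≤ M) ∧ (∀ y, 1 < ‖y‖ → η y = 0) ∧ ∫ y, η y = 1 := by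
  let b : ContDiffBump (0 : EuclideanSpace ℝ (Fin d)) := ⟨1 / 2, 1, by norm_num, by norm_num⟩
  obtain ⟨M, hM0, hM⟩ := exists_abs_le_of_hasCompactSupport
    (b.continuous_normed (μ := volume)) b.hasCompactSupport_normed
  refine ⟨b.normed volume, M + 1, b.contDiff_normed, by linarith, b.nonneg_normed, fun y => ?_,
    fun y hy => ?_, b.integral_normed⟩
  · linarith [le_abs_self (b.normed volume y), hM y]
  · rw [ContDiffBump.normed_def, b.zero_of_le_dist (by rw [dist_zero_right]; exact hy.le), zero_div]

theorem exists_cutoff (d : ℕ) : ∃ (χ : EuclideanSpace ℝ (Fin d) → ℝ) (M : ℝ), ContDiff ℝ ∞ χ ∧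
    0 ≤ M ∧ (∀ y, 0 ≤ χ y) ∧ (∀ y, χ y ≤ 1) ∧ (∀ y, ‖y‖ ≤ 4 / 5 → χ y = 1) ∧
    (∀ y, 9 / 10 ≤ ‖y‖ → χ y = 0) ∧ (∀ k y, |pderiv' k χ y| ≤ M) ∧
    (∀ k y, ‖y‖ < 4 / 5 → pderiv' k χ y = 0) ∧ (∀ k y, 9 / 10 < ‖y‖ → pderiv' k χ y = 0) := by
  let b : ContDiffBump (0 : EuclideanSpace ℝ (Fin d)) := ⟨4 / 5, 9 / 10, by norm_num, by norm_num⟩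
  have hb : ContDiff ℝ ∞ b := b.contDiff
  have hone : ∀ y, ‖y‖ ≤ 4 / 5 → b y = 1 := fun y hy =>
    b.one_of_mem_closedBall (mem_closedBall_zero_iff.2 hy)
  have hzero : ∀ y, 9 / 10 ≤ ‖y‖ → b y = 0 := fun y hy =>
    b.zero_of_le_dist (by rw [dist_zero_right]; exact hy)
  have hM : ∀ k, ∃ M, 0 ≤ M ∧ ∀ y, |pderiv' k b y| ≤ M := fun k =>
    exists_abs_le_of_hasCompactSupport (contDiff_pderiv' hb k).continuous
      (b.hasCompactSupport.pderiv' k)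
  choose M hM0 hM using hM
  refine ⟨b, ∑ k, M k, hb, Finset.sum_nonneg fun k _ => hM0 k, fun y => b.nonneg,
    fun y => b.le_one, hone, hzero, fun k y => (hM k y).trans
      (Finset.single_le_sum (fun k _ => hM0 k) (Finset.mem_univ k)), fun k y hy => ?_,
    fun k y hy => ?_⟩
  · have : b =ᶠ[𝓝 y] fun _ => 1 := by
      filter_upwards [isOpen_ball.mem_nhds (mem_ball_zero_iff.2 hy)] with x hx
      exact hone x (mem_ball_zero_iff.1 hx).le
    simp [pderiv', this.fderiv_eq]
  · have : b =ᶠ[𝓝 y] fun _ => 0 := by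
      filter_upwards [isClosed_closedBall.isOpen_compl.mem_nhds
        (show y ∈ (closedBall 0 (9 / 10))ᶜ by simpa using hy)] with x hx
      exact hzero x (by simpa using (show x ∉ closedBall 0 (9 / 10) from hx) : 9 / 10 < ‖x‖).le
    simp [pderiv', this.fderiv_eq]

theorem pderiv'_mul {f g : EuclideanSpace ℝ (Fin d) → ℝ} {x : EuclideanSpace ℝ (Fin d)}
    (hf : DifferentiableAt ℝ f x) (hg : DifferentiableAt ℝ g x) (k : Fin d) :
    pderiv' k (fun y => f y * g y) x = pderiv' k f x * g x + f x * pderiv' k g x := by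
  have h : HasFDerivAt (fun y => f y * g y) _ x := hf.hasFDerivAt.mul hg.hasFDerivAt
  rw [pderiv', h.fderiv]
  simp [pderiv']
  ring

theorem pderiv'_sub_const (f : EuclideanSpace ℝ (Fin d) → ℝ) (c : ℝ) (k : Fin d)
    (x : EuclideanSpace ℝ (Fin d)) : pderiv' k (fun y => f y - c) x = pderiv' k f x := by
  simp [pderiv', fderiv_sub_const]

theorem integral_sq_le_of_abs_le {f g : EuclideanSpace ℝ (Fin d) → ℝ} {a b : ℝ}
    (hg : Integrable fun x => g x ^ 2)
    (hf0 : ∀ x ∉ ball (0 : EuclideanSpace ℝ (Fin d)) 1, f x = 0)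
    (hfg : ∀ x, |f x| ≤ a * |g x| + b) :
    ∫ x, f x ^ 2 ≤ 2 * a ^ 2 * (∫ x, g x ^ 2)
      + 2 * b ^ 2 * volume.real (ball (0 : EuclideanSpace ℝ (Fin d)) 1) := by
  have hi : Integrable ((ball (0 : EuclideanSpace ℝ (Fin d)) 1).indicator fun _ => 2 * b ^ 2)
      volume := (integrable_indicator_iff measurableSet_ball).2
        (integrableOn_const measure_ball_lt_top.ne)
  calc ∫ x, f x ^ 2 ≤ ∫ x, (2 * a ^ 2 * g x ^ 2
        + (ball (0 : EuclideanSpace ℝ (Fin d)) 1).indicator (fun _ => 2 * b ^ 2) x) := by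
        refine integral_mono_of_nonneg (Eventually.of_forall fun x => sq_nonneg _)
          ((hg.const_mul _).add hi) (Eventually.of_forall fun x => ?_)
        by_cases hx : x ∈ ball (0 : EuclideanSpace ℝ (Fin d)) 1
        · simp only [Set.indicator_of_mem hx]
          have h1 := hfg x
          have h2 : f x ^ 2 ≤ (a * |g x| + b) ^ 2 := by
            rw [← sq_abs (f x)]
            gcongr
          nlinarith [sq_nonneg (a * |g x| - b), sq_abs (g x)]
        · simp only [Set.indicator_of_notMem hx, hf0 x hx]
          nlinarith [mul_nonneg (sq_nonneg a) (sq_nonneg (g x))]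
    _ = _ := by
        rw [integral_add (hg.const_mul _) hi, integral_const_mul,
          integral_indicator_const _ measurableSet_ball, smul_eq_mul]
        ring

theorem exists_setIntegral_sq_sub_le (hd : 0 < d) : ∃ C κ₀ : ℝ, 0 < C ∧ 0 < κ₀ ∧
    ∀ (u : EuclideanSpace ℝ (Fin d) → ℝ) (W : Fin d → Fin d → EuclideanSpace ℝ (Fin d) → ℝ)
      (c κ : ℝ), ContDiff ℝ ∞ u → (∀ k l, ContDiff ℝ ∞ (W k l)) → 0 < c → 0 < κ → κ ≤ κ₀ →
      (∀ k z, ‖z‖ ≤ 9 / 10 → pderiv' k u z = ∑ l, pderiv' l (W k l) z) →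
      (∀ k l z, ‖z‖ ≤ 9 / 10 → |W k l z| ≤ κ * |u z - c| + 2 * κ * c) →
      (∀ z, 4 / 5 ≤ ‖z‖ → ‖z‖ ≤ 9 / 10 → |u z - c| ≤ κ * c) →
      ∫ z in ball 0 (4 / 5), (u z - c) ^ 2 ≤ C * κ ^ 2 * c ^ 2 := by
  obtain ⟨C, hC, hCmain⟩ := exists_integral_sq_le_of_grad_eq_div hd
  obtain ⟨χ, M, hχ, hM0, hχ0, hχ1, hχone, hχzero, hχM, hχin, hχout⟩ := exists_cutoff d
  set V := volume.real (ball (0 : EuclideanSpace ℝ (Fin d)) 1) with hV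
  have hd' : (0 : ℝ) < d := by exact_mod_cast hd
  refine ⟨2 * (C * (8 * d ^ 2 * V + 2 * d * (M * (1 + 3 * d)) ^ 2 * V)) + 1,
    min 1 (1 / (4 * (C * d ^ 2) + 1)), by positivity, by positivity, ?_⟩
  intro u W c κ hu hW hc hκ hκ0 hgrad hWle hann
  have hκ1 : κ ≤ 1 := hκ0.trans (min_le_left _ _)
  have hκC : C * d ^ 2 * (2 * κ ^ 2) ≤ 1 / 2 := by
    have h1 := hκ0.trans (min_le_right _ _)
    rw [le_div_iff₀ (by positivity)] at h1
    have h2 : κ ^ 2 ≤ κ := by nlinarith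
    have h3 : 0 < C * d ^ 2 := by positivity
    nlinarith
  have huc : ContDiff ℝ ∞ fun z => u z - c := hu.sub contDiff_const
  let g : EuclideanSpace ℝ (Fin d) → ℝ := fun z => χ z * (u z - c)
  let X : Fin d → Fin d → EuclideanSpace ℝ (Fin d) → ℝ := fun k l z => χ z * W k l z
  let r : Fin d → EuclideanSpace ℝ (Fin d) → ℝ := fun k z =>
    pderiv' k χ z * (u z - c) - ∑ l, pderiv' l χ z * W k l z
  have hχc : HasCompactSupport χ := HasCompactSupport.of_support_subset_isCompact
    (isCompact_closedBall 0 (9 / 10)) fun y hy => by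
      by_contra h
      exact hy (hχzero y (by simpa using h : 9 / 10 < ‖y‖).le)
  have hg : ContDiff ℝ ∞ g := hχ.mul huc
  have hgc : HasCompactSupport g := hχc.mul_right
  have hout : ∀ x ∉ ball (0 : EuclideanSpace ℝ (Fin d)) 1, 9 / 10 < ‖x‖ := fun x hx => by
    have : 1 ≤ ‖x‖ := by simpa using hx
    linarith
  have hg0 : ∀ x ∉ ball (0 : EuclideanSpace ℝ (Fin d)) 1, g x = 0 := fun x hx => by
    simp only [g, hχzero x (hout x hx).le, zero_mul]
  have hr : ∀ k, ContDiff ℝ ∞ (r k) := fun k => ((contDiff_pderiv' hχ k).mul huc).sub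
    (ContDiff.sum fun l _ => (contDiff_pderiv' hχ l).mul (hW k l))
  have hrc : ∀ k, HasCompactSupport (r k) := fun k =>
    HasCompactSupport.of_support_subset_isCompact (isCompact_closedBall 0 (9 / 10)) fun y hy => by
      by_contra h
      have h' : 9 / 10 < ‖y‖ := by simpa using h
      exact hy (by simp [r, hχout _ y h'])
  have hmain := hCmain g X r hg hgc hg0 (fun k l => hχ.mul (hW k l)) (fun k l => hχc.mul_right)
    hr hrc (fun k x => ?_)
  · have hgi : Integrable fun x => g x ^ 2 := by
      simp_rw [sq]
      exact (hg.continuous.mul hg.continuous).integrable_of_hasCompactSupport hgc.mul_right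
    have hX : ∀ k l, ∫ x, X k l x ^ 2
        ≤ 2 * κ ^ 2 * (∫ x, g x ^ 2) + 2 * (2 * κ * c) ^ 2 * V := by
      intro k l
      refine integral_sq_le_of_abs_le hgi (fun x hx => ?_) fun x => ?_
      · simp only [X, hχzero x (hout x hx).le, zero_mul]
      · rcases le_total ‖x‖ (9 / 10) with h | h
        · simp only [X, g, abs_mul, abs_of_nonneg (hχ0 x)]
          nlinarith [hWle k l x h, hχ0 x, hχ1 x, mul_pos hκ hc,
            mul_le_mul_of_nonneg_left (hWle k l x h) (hχ0 x)]
        · simp only [X, g, hχzero x h, zero_mul, abs_zero]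
          positivity
    have hrk : ∀ k, ∫ x, r k x ^ 2
        ≤ 2 * 0 ^ 2 * (∫ x, g x ^ 2) + 2 * (M * (1 + 3 * d) * (κ * c)) ^ 2 * V := by
      intro k
      refine integral_sq_le_of_abs_le hgi (fun x hx => ?_) fun x => ?_
      · simp [r, hχout _ x (hout x hx)]
      · rw [zero_mul, zero_add]
        by_cases h : 4 / 5 ≤ ‖x‖ ∧ ‖x‖ ≤ 9 / 10
        · have h1 := hann x h.1 h.2
          have h2 : ∀ l, |W k l x| ≤ 3 * (κ * c) := fun l => by
            have := hWle k l x h.2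
            nlinarith [mul_pos hκ hc, abs_nonneg (u x - c)]
          calc |r k x| ≤ |pderiv' k χ x * (u x - c)| + |∑ l, pderiv' l χ x * W k l x| :=
                abs_sub _ _
            _ ≤ M * (κ * c) + ∑ _l : Fin d, M * (3 * (κ * c)) := by
                gcongr
                · rw [abs_mul]
                  exact mul_le_mul (hχM k x) h1 (abs_nonneg _) hM0
                · refine (Finset.abs_sum_le_sum_abs _ _).trans (Finset.sum_le_sum fun l _ => ?_)
                  rw [abs_mul]
                  exact mul_le_mul (hχM l x) (h2 l) (abs_nonneg _) hM0
            _ = _ := by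
                rw [Finset.sum_const, Finset.card_univ, Fintype.card_fin, nsmul_eq_mul]
                ring
        · have : ∀ l, pderiv' l χ x = 0 := fun l => by
            by_cases h' : ‖x‖ < 4 / 5
            · exact hχin l x h'
            · exact hχout l x (not_le.1 fun h2 => h ⟨not_lt.1 h', h2⟩)
          simp only [r, this, zero_mul, Finset.sum_const_zero, sub_zero, abs_zero]
          positivity
    have hJ : ∫ z in ball 0 (4 / 5), (u z - c) ^ 2 ≤ ∫ x, g x ^ 2 := by
      rw [setIntegral_congr_fun (g := fun x => g x ^ 2) measurableSet_ball fun x hx => by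
        simp [g, hχone x (mem_ball_zero_iff.1 hx).le]]
      exact setIntegral_le_integral hgi (Eventually.of_forall fun x => sq_nonneg _)
    refine hJ.trans ?_
    have hX' := Finset.sum_le_sum fun k (_ : k ∈ Finset.univ) =>
      Finset.sum_le_sum fun l (_ : l ∈ Finset.univ) => hX k l
    have hr' := Finset.sum_le_sum fun k (_ : k ∈ Finset.univ) => hrk k
    simp only [Finset.sum_const, Finset.card_univ, Fintype.card_fin, nsmul_eq_mul] at hX' hr'
    have h4 := hmain.trans (mul_le_mul_of_nonneg_left (add_le_add hX' hr') hC.le)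
    have hJ0 : 0 ≤ ∫ x, g x ^ 2 := integral_nonneg fun x => sq_nonneg _
    nlinarith [mul_le_mul_of_nonneg_right hκC hJ0, sq_nonneg (κ * c)]
  · have hχd := hχ.differentiable (by simp) x
    have hud := huc.differentiable (by simp) x
    have hWd : ∀ l, DifferentiableAt ℝ (W k l) x := fun l => (hW k l).differentiable (by simp) x
    simp only [g, X, r]
    rw [pderiv'_mul hχd hud, pderiv'_sub_const]
    simp only [pderiv'_mul hχd (hWd _), Finset.sum_add_distrib, ← Finset.mul_sum]
    rcases le_total ‖x‖ (9 / 10) with h | h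
    · rw [hgrad k x h]
      ring
    · rw [hχzero x h]
      ring

end Cutoff

section Rigidity

variable {d : ℕ}

theorem norm_fderiv_le_of_abs_pderiv'_le {u : EuclideanSpace ℝ (Fin d) → ℝ}
    {z : EuclideanSpace ℝ (Fin d)} {B : ℝ} (hB : 0 ≤ B) (h : ∀ k, |pderiv' k u z| ≤ B) :
    ‖fderiv ℝ u z‖ ≤ d * B := by
  refine ContinuousLinearMap.opNorm_le_bound _ (by positivity) fun v => ?_
  rw [fderiv_apply_eq_sum]
  calc ‖∑ l, v l * pderiv' l u z‖ ≤ ∑ _l : Fin d, ‖v‖ * B := by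
        refine norm_sum_le_of_le _ fun l _ => ?_
        rw [norm_mul]
        exact mul_le_mul (PiLp.norm_apply_le v l) (h l) (abs_nonneg _) (norm_nonneg _)
    _ = d * B * ‖v‖ := by
        rw [Finset.sum_const, Finset.card_univ, Fintype.card_fin, nsmul_eq_mul]
        ring

theorem exists_abs_smear_const_sub_le {T : ℝ} (hT : 0 < T) (hT1 : T < 1 / 10)
    {η : EuclideanSpace ℝ (Fin d) → ℝ} (hη : ContDiff ℝ ∞ η) (hη1 : ∀ y, 1 < ‖y‖ → η y = 0) :
    ∃ C : ℝ, 0 ≤ C ∧ ∀ (ν τ : Measure (EuclideanSpace ℝ (Fin d))) [IsFiniteMeasure ν]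
      [IsFiniteMeasure τ] (q : Fin d → Fin d → EuclideanSpace ℝ (Fin d) → ℝ),
      (∀ k l, Measurable (q k l)) → (∀ k l x, |q k l x| ≤ 1) → GradEqDiv ν τ q →
      ∀ z, ‖z‖ ≤ 9 / 10 → |smear ν (fun _ => 1) (fun _ => T) η z
        - smear ν (fun _ => 1) (fun _ => T) η 0| ≤ C * τ.real Set.univ := by
  have hηc := hasCompactSupport_of_eq_zero_of_one_lt_norm hη1
  have hM : ∀ k, ∃ M, 0 ≤ M ∧ ∀ y, |pderiv' k η y| ≤ M := fun k =>
    exists_abs_le_of_hasCompactSupport (contDiff_pderiv' hη k).continuous (hηc.pderiv' k)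
  choose M hM0 hM using hM
  have hS0 : 0 ≤ ∑ l, T⁻¹ * (T⁻¹ ^ d * M l) := Finset.sum_nonneg fun l _ => by
    have := hM0 l
    positivity
  refine ⟨d * (∑ l, T⁻¹ * (T⁻¹ ^ d * M l)) * (9 / 10), by positivity, ?_⟩
  intro ν τ _ _ q hq hq1 hνq z hz
  have hp : ∀ k, ∀ w, ‖w‖ ≤ 9 / 10 → |pderiv' k (smear ν (fun _ => 1) (fun _ => T) η) w|
      ≤ (∑ l, T⁻¹ * (T⁻¹ ^ d * M l)) * τ.real Set.univ := by
    intro k w hw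
    rw [pderiv'_smear_eq_sum_pderiv'_smearField (T := T) (κ := 0) hνq hq hq1 contDiff_const hT
      (fun _ => le_rfl) (fun _ => le_rfl) (by simp) hη hη1 k (by linarith), Finset.sum_mul]
    refine (Finset.abs_sum_le_sum_abs _ _).trans (Finset.sum_le_sum fun l _ => ?_)
    have h1 : smearField ν τ q (fun _ => T) η k l = smear τ (q k l) (fun _ => T) η := by
      funext y
      simp [smearField, pderiv', smear]
    rw [h1, pderiv'_smear (hq k l) (hq1 k l) measurable_const hT (fun _ => le_rfl) hη hηc]
    have h2 : ∀ x, |q k l x * T⁻¹| ≤ T⁻¹ := fun x => by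
      rw [abs_mul, abs_of_pos (inv_pos.2 hT)]
      exact mul_le_of_le_one_left (inv_pos.2 hT).le (hq1 k l x)
    exact norm_integral_le_of_norm_le_const
      (f := fun x => q k l x * T⁻¹ * (T⁻¹ ^ d * pderiv' l η (T⁻¹ • (w - x))))
      (Eventually.of_forall fun x => abs_smear_kernel_le (t := fun _ => T)
        (b := fun x => q k l x * T⁻¹) h2 hT
        (fun _ => le_rfl) (hM l) x w)
  have hsm : ContDiff ℝ ∞ (smear ν (fun _ => 1) (fun _ => T) η) :=
    contDiff_smear (B := 1) measurable_const (by simp) measurable_const hT (fun _ => le_rfl) hη hηc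
  have hmv := (convex_closedBall (0 : EuclideanSpace ℝ (Fin d))
    (9 / 10)).norm_image_sub_le_of_norm_fderiv_le (𝕜 := ℝ) (x := 0) (y := z)
    (fun w _ => hsm.differentiable (by simp) w)
    (fun w hw => norm_fderiv_le_of_abs_pderiv'_le (by positivity)
      fun k => hp k w (mem_closedBall_zero_iff.1 hw))
    (mem_closedBall_self (by norm_num)) (mem_closedBall_zero_iff.2 hz)
  rw [Real.norm_eq_abs, sub_zero] at hmv
  refine hmv.trans ?_
  calc _ ≤ d * ((∑ l, T⁻¹ * (T⁻¹ ^ d * M l)) * τ.real Set.univ) * (9 / 10) := by gcongr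
    _ = _ := by ring

variable {t η : EuclideanSpace ℝ (Fin d) → ℝ} {κ : ℝ}

theorem smear_eq_smear_const {ν : Measure (EuclideanSpace ℝ (Fin d))} (hκ : 0 < κ)
    (hκ1 : κ ≤ 1 / 4) (htpos : ∀ x, 0 < t x) (htT : ∀ x, t x ≤ κ / 5)
    (htout : ∀ x, 3 / 4 ≤ ‖x‖ → t x = κ / 10) (hη1 : ∀ y, 1 < ‖y‖ → η y = 0)
    {z : EuclideanSpace ℝ (Fin d)} (hz : 4 / 5 ≤ ‖z‖) :
    smear ν (fun _ => 1) t η z = smear ν (fun _ => 1) (fun _ => κ / 10) η z := by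
  refine integral_congr_ae (Eventually.of_forall fun x => ?_)
  rcases le_or_gt (3 / 4) ‖x‖ with hx | hx
  · simp only [htout x hx]
  · have h1 : 1 / 20 < dist z x := by
      have := norm_sub_norm_le z x
      rw [dist_eq_norm]
      linarith
    have h2 := kernel_eq_zero htpos hη1 ((htT x).trans_lt (show κ / 5 < dist z x by linarith))
    have h3 := kernel_eq_zero (t := fun _ => κ / 10) (fun _ => by positivity) hη1
      (show κ / 10 < dist z x by linarith)
    simp only [h2, h3, mul_zero]

theorem smear_le_of_scale {τ : Measure (EuclideanSpace ℝ (Fin d))} [IsFiniteMeasure τ] {M s : ℝ}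
    (hκ : 0 < κ) (hκ1 : κ ≤ 1 / 4) (hs : 0 < s) (htpos : ∀ x, 0 < t x) (htT : ∀ x, t x ≤ κ / 5)
    (htL : ∀ x y, |t x - t y| ≤ κ * dist x y) {F : Set (EuclideanSpace ℝ (Fin d))}
    (hF : F.Nonempty) (htF : ∀ x, min (κ / 10) (κ * infDist x F) ≤ 2 * t x)
    (hFτ : Disjoint F (denseBalls τ s)) (hτ : τ.real Set.univ ≤ s * (1 / 5) ^ d)
    (hη0 : ∀ y, 0 ≤ η y) (hη1 : ∀ y, 1 < ‖y‖ → η y = 0)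
    (hM : ∀ y, η y ≤ M) (z : EuclideanSpace ℝ (Fin d)) :
    smear τ (fun _ => 1) t η z ≤ M * s * (6 / κ) ^ d := by
  have hM0 : 0 ≤ M := (hη0 0).trans (hM 0)
  have hz := htpos z
  have hR0 : 0 < 4 * t z / κ := by positivity
  have hball : τ.real (closedBall z (4 * t z / κ)) ≤ s * (4 * t z / κ) ^ d := by
    rcases min_le_iff.1 (htF z) with h | h
    · refine (measureReal_mono (Set.subset_univ _)).trans (hτ.trans ?_)
      have h5 : 1 / 5 ≤ 4 * t z / κ := by
        rw [le_div_iff₀ hκ]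
        linarith
      gcongr
    · have h1 : infDist z F < 4 * t z / κ := by
        rw [lt_div_iff₀ hκ]
        linarith
      obtain ⟨w, hwF, hw⟩ := (infDist_lt_iff hF).1 h1
      have hnot : ¬ ENNReal.ofReal (s * (4 * t z / κ) ^ d) ≤ τ (closedBall z (4 * t z / κ)) := by
        intro hle
        refine Set.disjoint_left.1 hFτ hwF (Set.mem_biUnion (x := (z, 4 * t z / κ)) ⟨hR0, ?_, hle⟩
          (by rwa [mem_ball, dist_comm]))
        simp only
        rw [div_le_one hκ]
        linarith [htT z]
      exact ENNReal.toReal_le_of_le_ofReal (by positivity) (not_le.1 hnot).le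
  have hsub : τ.real (closedBall z (2 * t z)) ≤ s * (4 * t z / κ) ^ d := by
    refine (measureReal_mono (closedBall_subset_closedBall ?_)).trans hball
    rw [le_div_iff₀ hκ]
    nlinarith
  calc smear τ (fun _ => 1) t η z
      ≤ (3 / 2 * (t z)⁻¹) ^ d * M * τ.real (closedBall z (2 * t z)) :=
        smear_one_le htL (by linarith) htpos hη0 hη1 hM z
    _ ≤ (3 / 2 * (t z)⁻¹) ^ d * M * (s * (4 * t z / κ) ^ d) := by gcongr
    _ = M * s * ((3 / 2 * (t z)⁻¹) * (4 * t z / κ)) ^ d := by rw [mul_pow (3 / 2 * (t z)⁻¹)]; ring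
    _ = M * s * (6 / κ) ^ d := by
        congr 2
        field_simp
        norm_num

theorem exists_isCompact_thickening_of_mutuallySingular
    {ν : Measure (EuclideanSpace ℝ (Fin d))} [IsFiniteMeasure ν]
    (h : ν ⟂ₘ volume) {ε₁ ε₂ : ℝ} (h₁ : 0 < ε₁) (h₂ : 0 < ε₂) :
    ∃ (K : Set (EuclideanSpace ℝ (Fin d))) (δ : ℝ), MeasurableSet K ∧ 0 < δ ∧
      ν.real Kᶜ ≤ ε₁ ∧ volume (thickening δ K) ≤ ENNReal.ofReal ε₂ := by
  obtain ⟨S, hS, hνS, hvS⟩ := h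
  obtain ⟨K, hKS, hK, hKν⟩ := hS.compl.exists_isCompact_sdiff_lt (μ := ν) (measure_ne_top _ _)
    (ENNReal.ofReal_pos.2 h₁).ne'
  have hvK : volume K < ENNReal.ofReal ε₂ := by
    rw [measure_mono_null hKS hvS]
    exact ENNReal.ofReal_pos.2 h₂
  obtain ⟨O, hKO, hO, hvO⟩ := K.exists_isOpen_lt_of_lt _ hvK
  obtain ⟨δ, hδ, hδO⟩ := hK.exists_thickening_subset_open hO hKO
  refine ⟨K, δ, hK.measurableSet, hδ, ?_, ?_⟩
  · refine ENNReal.toReal_le_of_le_ofReal h₁.le ?_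
    calc ν Kᶜ ≤ ν (S ∪ Sᶜ \ K) := measure_mono fun x hx => by
          by_cases hxS : x ∈ S
          · exact Or.inl hxS
          · exact Or.inr ⟨hxS, hx⟩
      _ ≤ ν S + ν (Sᶜ \ K) := measure_union_le _ _
      _ ≤ ENNReal.ofReal ε₁ := by rw [hνS, zero_add]; exact hKν.le
  · exact (measure_mono hδO).trans hvO.le

end Rigidity

section Rigidity

variable {d : ℕ}

theorem half_le_measureReal_diff {B U O : Set (EuclideanSpace ℝ (Fin d))} (hB : volume B ≠ ⊤)
    (hU : volume.real U ≤ volume.real B / 4) (hU' : volume U ≠ ⊤)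
    (hO : volume.real O ≤ volume.real B / 4) (hO' : volume O ≠ ⊤) :
    volume.real B / 2 ≤ volume.real (B \ (U ∪ O)) := by
  have h1 : volume.real B ≤ volume.real ((B \ (U ∪ O)) ∪ (U ∪ O)) :=
    measureReal_mono (by intro x hx; by_cases h : x ∈ U ∪ O <;> simp_all)
      (measure_union_ne_top (measure_ne_top_of_subset Set.sdiff_subset hB)
        (measure_union_ne_top hU' hO'))
  have h2 := measureReal_union_le (μ := volume) (B \ (U ∪ O)) (U ∪ O)
  have h3 := measureReal_union_le (μ := volume) U O
  linarith

theorem exists_not_gradEqDiv (hd : 0 < d) {a : ℝ} (ha : 0 < a) : ∃ ε : ℝ, 0 < ε ∧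
    ∀ (ν τ : Measure (EuclideanSpace ℝ (Fin d))) [IsFiniteMeasure ν] [IsFiniteMeasure τ]
      (q : Fin d → Fin d → EuclideanSpace ℝ (Fin d) → ℝ),
      (∀ k l, Measurable (q k l)) → (∀ k l x, |q k l x| ≤ 1) → ν ⟂ₘ volume →
      a ≤ ν.real (ball 0 (1 / 2)) → τ.real Set.univ ≤ ε → ¬ GradEqDiv ν τ q := by
  obtain ⟨η, M, hη, hM0, hη0, hM, hη1, hηI⟩ := exists_mollifier d
  obtain ⟨C₃, κ₀, hC₃, hκ₀, hcore⟩ := exists_setIntegral_sq_sub_le hd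
  set V₁ := volume.real (ball (0 : EuclideanSpace ℝ (Fin d)) 1) with hV₁
  set Vh := volume.real (ball (0 : EuclideanSpace ℝ (Fin d)) (1 / 2)) with hVh
  have hV₁0 : 0 < V₁ := ENNReal.toReal_pos (measure_ball_pos _ _ one_pos).ne' measure_ball_lt_top.ne
  have hVh0 : 0 < Vh := ENNReal.toReal_pos (measure_ball_pos _ _ (by norm_num)).ne'
    measure_ball_lt_top.ne
  obtain ⟨κ, hκ, hκ1, hκκ₀, hκC⟩ : ∃ κ : ℝ, 0 < κ ∧ κ ≤ 1 / 4 ∧ κ ≤ κ₀ ∧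
      C₃ * κ ^ 2 ≤ Vh / 16 := by
    refine ⟨min (1 / 4) (min κ₀ (Vh / 16 / C₃)), by positivity, min_le_left _ _,
      (min_le_right _ _).trans (min_le_left _ _), ?_⟩
    set κ := min (1 / 4) (min κ₀ (Vh / 16 / C₃))
    have h1 : κ ≤ 1 / 4 := min_le_left _ _
    have h2 : κ ≤ Vh / 16 / C₃ := (min_le_right _ _).trans (min_le_right _ _)
    have h0 : 0 < κ := by positivity
    rw [le_div_iff₀ hC₃] at h2
    nlinarith
  obtain ⟨C₀, hC₀, hconst⟩ := exists_abs_smear_const_sub_le (T := κ / 10) (by positivity)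
    (by linarith) hη hη1
  set c₀ := a / (2 * V₁) with hc₀def
  have hc₀ : 0 < c₀ := by positivity
  set s := κ * c₀ / ((1 + d * κ) * (M * (6 / κ) ^ d)) with hs_def
  have hs : 0 < s := by positivity
  have hsκ : (1 + d * κ) * (M * s * (6 / κ) ^ d) = κ * c₀ := by
    rw [hs_def]
    field_simp
  obtain ⟨ε, hε, hε1, hε2, hε3⟩ : ∃ ε : ℝ, 0 < ε ∧ C₀ * ε ≤ κ * c₀ ∧ ε ≤ s * (1 / 5) ^ d ∧
      5 ^ d / s * V₁ * ε ≤ Vh / 4 := by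
    refine ⟨min (κ * c₀ / (C₀ + 1)) (min (s * (1 / 5) ^ d) (Vh / 4 / (5 ^ d / s * V₁))),
      by positivity, ?_, (min_le_right _ _).trans (min_le_left _ _), ?_⟩
    · refine (mul_le_mul_of_nonneg_left (min_le_left _ _) hC₀).trans ?_
      rw [← mul_div_assoc, div_le_iff₀ (by positivity)]
      nlinarith [mul_pos hκ hc₀]
    · refine (mul_le_mul_of_nonneg_left ((min_le_right _ _).trans (min_le_right _ _))
        (by positivity)).trans (le_of_eq ?_)
      field_simp
  refine ⟨ε, hε, ?_⟩
  intro ν τ _ _ q hq hq1 hsing hνa hτε hνq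
  set u₀ := smear ν (fun _ => 1) (fun _ => κ / 10) η with hu₀
  have hκ10 : 0 < κ / 10 := by positivity
  have hηc := hasCompactSupport_of_eq_zero_of_one_lt_norm hη1
  have hu₀c : ∀ z, ‖z‖ ≤ 9 / 10 → |u₀ z - u₀ 0| ≤ κ * c₀ := fun z hz =>
    (hconst ν τ q hq hq1 hνq z hz).trans ((mul_le_mul_of_nonneg_left hτε hC₀).trans hε1)
  set c := u₀ 0 with hc_def
  have hc0 : 0 ≤ c := smear_nonneg (fun _ => hκ10) hη0 0
  have hu₀s : ContDiff ℝ ∞ u₀ := contDiff_smear (B := 1) measurable_const (by simp)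
    measurable_const hκ10 (fun _ => le_rfl) hη hηc
  have hcc₀ : c₀ ≤ c := by
    have h1 : ν.real (ball 0 (1 / 2)) ≤ ∫ z in ball 0 (9 / 10), u₀ z :=
      measureReal_ball_le_setIntegral_smear (T := κ / 10) measurable_const hκ10
        (fun _ => le_rfl) (fun _ => le_rfl) hη.continuous hη0 hη1 hηI (by linarith)
    have h2 : ‖∫ z in ball 0 (9 / 10), u₀ z‖ ≤ (c + κ * c₀) *
        volume.real (ball (0 : EuclideanSpace ℝ (Fin d)) (9 / 10)) :=
      norm_setIntegral_le_of_norm_le_const measure_ball_lt_top fun z hz => by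
        rw [Real.norm_of_nonneg (smear_nonneg (fun _ => hκ10) hη0 z)]
        linarith [(abs_le.1 (hu₀c z (mem_ball_zero_iff.1 hz).le)).2]
    have h3 : volume.real (ball (0 : EuclideanSpace ℝ (Fin d)) (9 / 10)) ≤ V₁ :=
      measureReal_mono (ball_subset_ball (by norm_num)) measure_ball_lt_top.ne
    have h4 : a ≤ (c + κ * c₀) * V₁ := by
      refine hνa.trans (h1.trans ((le_abs_self _).trans (h2.trans ?_)))
      gcongr
    have h5 : a = 2 * c₀ * V₁ := by
      rw [hc₀def]
      field_simp
    rw [h5] at h4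
    have h6 := le_of_mul_le_mul_right h4 hV₁0
    nlinarith
  have hc : 0 < c := hc₀.trans_le hcc₀
  obtain ⟨K, δ₀, hKm, hδ₀, hKν, hKv⟩ := exists_isCompact_thickening_of_mutuallySingular hsing
    (ε₁ := c₀ * Vh / 16) (ε₂ := Vh / 4) (by positivity) (by positivity)
  have hU : volume (denseBalls τ s) ≤ ENNReal.ofReal (Vh / 4) := by
    refine (volume_denseBalls_le τ hs).trans ?_
    have e1 : volume (ball (0 : EuclideanSpace ℝ (Fin d)) 1) = ENNReal.ofReal V₁ :=
      (ofReal_measureReal measure_ball_lt_top.ne).symm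
    have e2 : τ Set.univ ≤ ENNReal.ofReal ε :=
      (ENNReal.le_ofReal_iff_toReal_le (measure_ne_top _ _) hε.le).2 hτε
    rw [e1, ← ENNReal.ofReal_mul (by positivity)]
    refine (mul_le_mul_right e2 _).trans ?_
    rw [← ENNReal.ofReal_mul (by positivity)]
    exact ENNReal.ofReal_le_ofReal hε3
  have hUtop : volume (denseBalls τ s) ≠ ⊤ := ne_top_of_le_ne_top ENNReal.ofReal_ne_top hU
  set B := ball (0 : EuclideanSpace ℝ (Fin d)) (1 / 2) with hB
  set O := thickening δ₀ K with hO
  have hBtop : volume B ≠ ⊤ := measure_ball_lt_top.ne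
  have hOtop : volume O ≠ ⊤ := ne_top_of_le_ne_top ENNReal.ofReal_ne_top hKv
  have hG := half_le_measureReal_diff hBtop
    (ENNReal.toReal_le_of_le_ofReal (by positivity) hU) hUtop
    (ENNReal.toReal_le_of_le_ofReal (by positivity) hKv) hOtop
  set G := B \ (denseBalls τ s ∪ O) with hGdef
  have hGm : MeasurableSet G := measurableSet_ball.diff
    ((isOpen_denseBalls τ s).union isOpen_thickening).measurableSet
  have hGtop : volume G ≠ ⊤ := measure_ne_top_of_subset Set.sdiff_subset hBtop
  set F := closedBall (0 : EuclideanSpace ℝ (Fin d)) (3 / 5) \ denseBalls τ s with hF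
  have hGF : G ⊆ F := fun x hx =>
    ⟨ball_subset_closedBall (ball_subset_ball (by norm_num) hx.1), fun h => hx.2 (Or.inl h)⟩
  have hFne : F.Nonempty := by
    refine Set.Nonempty.mono hGF (Set.nonempty_iff_ne_empty.2 fun h => ?_)
    rw [h, measureReal_empty] at hG
    have : 0 < volume.real B := hVh0
    linarith
  obtain ⟨δ, hδ, hδδ₀, hδκ⟩ : ∃ δ : ℝ, 0 < δ ∧ 2 * δ < δ₀ ∧ δ ≤ κ / 10 :=
    ⟨min (δ₀ / 4) (κ / 10), by positivity, by linarith [min_le_left (δ₀ / 4) (κ / 10)],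
      min_le_right _ _⟩
  obtain ⟨t, ht, htδ, htT, htout, htκ, htL, htF, htF'⟩ :=
    exists_contDiff_scale hκ hκ1 hδ hδκ hFne Set.sdiff_subset
  have hδ2 : 0 < δ / 2 := by positivity
  have htpos : ∀ x, 0 < t x := fun x => hδ2.trans_le (htδ x)
  set u := smear ν (fun _ => 1) t η with hu
  have hus : ContDiff ℝ ∞ u := contDiff_smear (B := 1) measurable_const (by simp)
    ht.continuous.measurable hδ2 htδ hη hηc
  have hann : ∀ z, 4 / 5 ≤ ‖z‖ → ‖z‖ ≤ 9 / 10 → |u z - c| ≤ κ * c := fun z h1 h2 => by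
    rw [hu, smear_eq_smear_const hκ hκ1 htpos htT htout hη1 h1]
    refine (hu₀c z h2).trans ?_
    gcongr
  have hW : ∀ k l z, ‖z‖ ≤ 9 / 10 →
      |smearField ν τ q t η k l z| ≤ κ * |u z - c| + 2 * κ * c := fun k l z _ => by
    have h1 := abs_smearField_le (ν := ν) (τ := τ) hq1 ht hδ2 htδ htκ hη.continuous hη0 hη1 k l z
    have h2 := smear_le_of_scale hκ hκ1 hs htpos htT htL hFne htF'
      (Set.disjoint_sdiff_left) (hτε.trans hε2) hη0 hη1 hM z
    have h3 : (1 + d * κ) * smear τ (fun _ => 1) t η z ≤ κ * c₀ := by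
      rw [← hsκ]
      gcongr
    have h4 : u z ≤ |u z - c| + c := by linarith [le_abs_self (u z - c)]
    have h5 : κ * u z ≤ κ * (|u z - c| + c) := by gcongr
    have h6 : κ * c₀ ≤ κ * c := by gcongr
    linarith
  have hJ := hcore u (smearField ν τ q t η) c κ hus
    (fun k l => contDiff_smearField hq hq1 ht hδ2 htδ htκ hη hηc k l) hc hκ hκκ₀
    (fun k z hz => pderiv'_smear_eq_sum_pderiv'_smearField hνq hq hq1 ht hδ2 htδ htT htκ hη hη1 k
      (by linarith)) hW hann
  have hGu : ∫ z in G, u z ≤ ν.real Kᶜ := by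
    refine setIntegral_smear_le ht.continuous.measurable hδ2 htδ hη.continuous hη0 hη1 hηI hKm
      hGtop fun x hx z hz => ?_
    by_contra! hle
    have h1 : infDist x F ≤ t x := (infDist_le_dist_of_mem (hGF hz)).trans
      (by rwa [dist_comm])
    have h2 : t x ≤ 2 * δ := by
      rcases le_total δ (κ * infDist x F) with h | h
      · have h3 := htF x
        rw [max_eq_right h] at h3
        have := htpos x
        nlinarith [infDist_nonneg (x := x) (s := F)]
      · simpa [max_eq_left h] using htF x
    exact hz.2 (Or.inr (mem_thickening_iff.2 ⟨x, hx, by linarith⟩))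
  have hGball : G ⊆ ball 0 (4 / 5) := fun x hx => ball_subset_ball (by norm_num) hx.1
  have hcont : ∀ {v : EuclideanSpace ℝ (Fin d) → ℝ}, Continuous v →
      IntegrableOn v (ball 0 (4 / 5)) := fun {v} hv =>
    (hv.continuousOn.integrableOn_compact (isCompact_closedBall 0 (4 / 5))).mono_set
      ball_subset_closedBall
  have hiu := (hcont hus.continuous).mono_set hGball
  have hi2 : IntegrableOn (fun z => (u z - c) ^ 2) (ball 0 (4 / 5)) :=
    hcont ((hus.continuous.sub continuous_const).pow 2)
  have hi2G : IntegrableOn (fun z => (2 * c)⁻¹ * (u z - c) ^ 2) G :=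
    (hi2.mono_set hGball).const_mul _
  have hJG : ∫ z in G, (u z - c) ^ 2 ≤ C₃ * κ ^ 2 * c ^ 2 :=
    (setIntegral_mono_set hi2 (Eventually.of_forall fun z => sq_nonneg _)
      hGball.eventuallyLE).trans hJ
  have hfin : c * volume.real G ≤ (∫ z in G, u z) + c / 2 * volume.real G
      + (2 * c)⁻¹ * ∫ z in G, (u z - c) ^ 2 := by
    have hic : ∀ b : ℝ, IntegrableOn (fun _ => b) G := fun b => integrableOn_const hGtop
    have e1 : ∀ b : ℝ, b * volume.real G = ∫ z in G, b := fun b => by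
      rw [setIntegral_const, smul_eq_mul, mul_comm]
    have hi3 : IntegrableOn (fun z => u z + c / 2) G := hiu.add (hic (c / 2))
    rw [e1, e1, ← integral_const_mul, ← integral_add hiu (hic _),
      ← integral_add hi3 hi2G]
    refine setIntegral_mono (hic c) (hi3.add hi2G) fun z => ?_
    have : u z + c / 2 + (2 * c)⁻¹ * (u z - c) ^ 2 - c = (2 * c)⁻¹ * u z ^ 2 := by
      field_simp
      ring
    have h2 : 0 ≤ (2 * c)⁻¹ * u z ^ 2 := by positivity
    simp only
    linarith
  have h7 : (2 * c)⁻¹ * ∫ z in G, (u z - c) ^ 2 ≤ (2 * c)⁻¹ * (Vh / 16 * c ^ 2) := by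
    gcongr
    exact hJG.trans (by gcongr)
  have h8 : (2 * c)⁻¹ * (Vh / 16 * c ^ 2) = c * Vh / 32 := by
    field_simp
    norm_num
  have h9 : c₀ * Vh / 16 ≤ c * Vh / 16 := by gcongr
  have h10 : c * (Vh / 2) ≤ c * volume.real G := by gcongr
  have := mul_pos hc hVh0
  linarith

end Rigidity

section Rescale

variable {d : ℕ}

theorem exists_left_inverse_of_injective_mulVec {n : ℕ} {M : Matrix (Fin n) (Fin d) ℝ}
    (hM : Function.Injective M.mulVec) : ∃ L : Matrix (Fin d) (Fin n) ℝ, L * M = 1 := by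
  obtain ⟨g, hg⟩ := (Matrix.toLin' M).exists_leftInverse_of_injective
    (LinearMap.ker_eq_bot.2 hM)
  refine ⟨LinearMap.toMatrix' g, ?_⟩
  have := congrArg LinearMap.toMatrix' hg
  rwa [LinearMap.toMatrix'_comp, LinearMap.toMatrix'_id, LinearMap.toMatrix'_toLin'] at this

/-- The image of `μ` under the dilation by `r⁻¹`, restricted to the unit ball and multiplied
by `w`. -/
noncomputable def rescale (w : ℝ≥0∞) (r : ℝ) (μ : Measure (EuclideanSpace ℝ (Fin d))) :
    Measure (EuclideanSpace ℝ (Fin d)) :=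
  w • ((Measure.map (fun x : EuclideanSpace ℝ (Fin d) => r⁻¹ • x) μ).restrict (ball 0 1))

variable {w : ℝ≥0∞} {r : ℝ} {μ : Measure (EuclideanSpace ℝ (Fin d))}

theorem isFiniteMeasure_rescale [IsFiniteMeasure μ] (hw : w ≠ ⊤) :
    IsFiniteMeasure (rescale w r μ) :=
  Measure.smul_finite _ hw

theorem integral_rescale (hr : 0 < r) {g : EuclideanSpace ℝ (Fin d) → ℝ}
    (hg : ∀ x ∉ ball (0 : EuclideanSpace ℝ (Fin d)) 1, g x = 0) :
    ∫ x, g x ∂(rescale w r μ) = w.toReal * ∫ x, g (r⁻¹ • x) ∂μ := by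
  rw [rescale, integral_smul_measure, smul_eq_mul,
    setIntegral_eq_integral_of_forall_compl_eq_zero hg,
    (measurableEmbedding_const_smul₀ (inv_ne_zero hr.ne')).integral_map]

theorem rescale_real_univ (hr : 0 < r) :
    (rescale w r μ).real Set.univ = w.toReal * μ.real (ball 0 r) := by
  have : (fun x : EuclideanSpace ℝ (Fin d) => r⁻¹ • x) ⁻¹' ball 0 1 = ball 0 r := by
    ext x
    rw [Set.mem_preimage, mem_ball_zero_iff, mem_ball_zero_iff, norm_smul, norm_inv,
      Real.norm_of_nonneg hr.le, ← div_eq_inv_mul, div_lt_one hr]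
  rw [rescale, measureReal_ennreal_smul_apply, measureReal_restrict_apply_univ, Measure.real,
    Measure.map_apply (measurable_const_smul _) measurableSet_ball, this]
  rfl

theorem mutuallySingular_rescale (hr : 0 < r) (h : μ ⟂ₘ volume) :
    rescale w r μ ⟂ₘ volume := by
  obtain ⟨S, hS, hμS, hvS⟩ := h
  have hS' : MeasurableSet ((fun x : EuclideanSpace ℝ (Fin d) => r • x) ⁻¹' S) :=
    measurable_const_smul r hS
  refine ⟨_, hS', ?_, ?_⟩
  · have h1 : Measure.map (fun x : EuclideanSpace ℝ (Fin d) => r⁻¹ • x) μ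
        ((fun x : EuclideanSpace ℝ (Fin d) => r • x) ⁻¹' S) = 0 := by
      rw [Measure.map_apply (measurable_const_smul _) hS', ← Set.preimage_comp]
      convert hμS
      ext x
      simp [smul_smul, hr.ne']
    rw [rescale, Measure.smul_apply, Measure.restrict_apply hS',
      measure_mono_null Set.inter_subset_left h1, smul_zero]
  · rw [← Set.preimage_compl, Measure.addHaar_preimage_smul _ hr.ne', hvS, mul_zero]

theorem pderiv'_comp_smul {φ : EuclideanSpace ℝ (Fin d) → ℝ} (hφ : ContDiff ℝ ∞ φ) (s : ℝ)
    (k : Fin d) (x : EuclideanSpace ℝ (Fin d)) :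
    pderiv' k (fun y => φ (s • y)) x = s * pderiv' k φ (s • x) := by
  have h : HasFDerivAt (fun y => φ (s • y)) _ x :=
    (hφ.differentiable (by simp) (s • x)).hasFDerivAt.comp x ((hasFDerivAt_id x).const_smul s)
  rw [pderiv', h.fderiv]
  simp [pderiv']

theorem pderiv'_eq_zero_of_notMem {φ : EuclideanSpace ℝ (Fin d) → ℝ}
    {s : Set (EuclideanSpace ℝ (Fin d))} (hφ : tsupport φ ⊆ s) (k : Fin d) {x}
    (hx : x ∉ s) : pderiv' k φ x = 0 := by
  rw [pderiv', fderiv_of_notMem_tsupport ℝ fun h => hx (hφ h)]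
  simp

theorem gradEqDiv_rescale {τ : Measure (EuclideanSpace ℝ (Fin d))}
    {q : Fin d → Fin d → EuclideanSpace ℝ (Fin d) → ℝ} (hr : 0 < r)
    (h : ∀ φ : EuclideanSpace ℝ (Fin d) → ℝ, ContDiff ℝ ∞ φ → HasCompactSupport φ →
      tsupport φ ⊆ ball 0 r →
      ∀ k, ∫ x, pderiv' k φ x ∂μ = ∑ l, ∫ x, pderiv' l φ x * q k l x ∂τ) :
    GradEqDiv (rescale w r μ) (rescale w r τ) fun k l x => q k l (r • x) := by
  intro φ hφ hφc hφs k
  have hsub : tsupport (fun y => φ (r⁻¹ • y)) ⊆ ball 0 r := by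
    intro x hx
    have h1 : r⁻¹ • x ∈ tsupport φ :=
      tsupport_comp_subset_preimage (f := fun y : EuclideanSpace ℝ (Fin d) => r⁻¹ • y) φ
        (continuous_const_smul _) hx
    have h2 := mem_ball_zero_iff.1 (hφs h1)
    rwa [norm_smul, norm_inv, Real.norm_of_nonneg hr.le, ← div_eq_inv_mul, div_lt_one hr,
      ← mem_ball_zero_iff] at h2
  have key := h (fun y => φ (r⁻¹ • y)) (hφ.comp (contDiff_const_smul _))
    (hφc.comp_smul (inv_ne_zero hr.ne')) hsub k
  simp only [pderiv'_comp_smul hφ, mul_assoc, integral_const_mul, ← Finset.mul_sum] at key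
  have key' := mul_left_cancel₀ (inv_ne_zero hr.ne') key
  rw [integral_rescale hr fun x hx => pderiv'_eq_zero_of_notMem hφs k hx, key', Finset.mul_sum]
  refine Finset.sum_congr rfl fun l _ => ?_
  rw [integral_rescale hr fun x hx => by rw [pderiv'_eq_zero_of_notMem hφs l hx, zero_mul]]
  simp [smul_smul, hr.ne']

end Rescale

section Reduction

variable {d m n : ℕ}

theorem exists_gradient_representation {A : Fin d → Matrix (Fin n) (Fin m) ℝ}
    {Ω : Set (EuclideanSpace ℝ (Fin d))}
    {ρ : Measure (EuclideanSpace ℝ (Fin d))} [IsFiniteMeasure ρ]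
    {f : EuclideanSpace ℝ (Fin d) → EuclideanSpace ℝ (Fin m)}
    (hf : AEStronglyMeasurable f ρ) (hpolar : ∀ᵐ x ∂ρ, ‖f x‖ = 1)
    (hfree : ∀ φ : EuclideanSpace ℝ (Fin d) → ℝ,
      ContDiff ℝ (⊤ : ℕ∞) φ → HasCompactSupport φ → tsupport φ ⊆ Ω →
      ∀ i : Fin n, ∑ l, ∑ j, A l i j * ∫ x, pderiv' l φ x * f x j ∂ρ = 0)
    {P₀ : EuclideanSpace ℝ (Fin m)} {c : ℝ} (hc : 0 < c)
    (hell : ∀ ξ : EuclideanSpace ℝ (Fin d),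
      c * ‖ξ‖ ≤ Real.sqrt (∑ i, (∑ l, ξ l * ∑ j, A l i j * P₀ j) ^ 2)) :
    ∃ (C : ℝ) (τ : Measure (EuclideanSpace ℝ (Fin d)))
      (q : Fin d → Fin d → EuclideanSpace ℝ (Fin d) → ℝ), 0 ≤ C ∧ IsFiniteMeasure τ ∧
      (∀ k l, Measurable (q k l)) ∧ (∀ k l x, |q k l x| ≤ 1) ∧
      (∀ φ : EuclideanSpace ℝ (Fin d) → ℝ, ContDiff ℝ ∞ φ → HasCompactSupport φ →
        tsupport φ ⊆ Ω → ∀ k, ∫ x, pderiv' k φ x ∂(ρ.singularPart volume)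
          = ∑ l, ∫ x, pderiv' l φ x * q k l x ∂τ) ∧
      ∀ B, MeasurableSet B → τ.real B ≤ C * ((∫ x in B, ‖f x - P₀‖ ∂(ρ.singularPart volume))
        + (volume.withDensity (ρ.rnDeriv volume)).real B) := by
  have hinj : Function.Injective
      (Matrix.of fun (i : Fin n) (l : Fin d) => ∑ j, A l i j * P₀ j).mulVec := by
    refine (injective_iff_map_eq_zero (Matrix.mulVecLin
      (Matrix.of fun (i : Fin n) (l : Fin d) => ∑ j, A l i j * P₀ j))).2 fun ξ hξ => ?_
    have h1 := hell (WithLp.toLp 2 ξ)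
    have h2 : ∀ i, ∑ l, ξ l * ∑ j, A l i j * P₀ j = 0 := fun i => by
      have := congrFun hξ i
      rw [Matrix.mulVecLin_apply] at this
      simp only [Matrix.mulVec, dotProduct, Matrix.of_apply, Pi.zero_apply] at this
      rw [← this]
      exact Finset.sum_congr rfl fun l _ => mul_comm _ _
    simp only [h2] at h1
    have h3 : ‖WithLp.toLp 2 ξ‖ ≤ 0 := by
      have : c * ‖WithLp.toLp 2 ξ‖ ≤ 0 := by simpa using h1
      nlinarith
    simpa using norm_le_zero_iff.1 h3
  obtain ⟨L, hL⟩ := exists_left_inverse_of_injective_mulVec hinj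
  let b : Fin d → Fin d → EuclideanSpace ℝ (Fin m) := fun k l =>
    WithLp.toLp 2 fun j => ∑ i, L k i * A l i j
  have hbP : ∀ k l, ∑ j, b k l j * P₀ j = if k = l then 1 else 0 := fun k l => by
    have := congrFun (congrFun hL k) l
    rw [Matrix.one_apply, Matrix.mul_apply] at this
    rw [← this]
    simp only [b, Matrix.of_apply, Finset.sum_mul, Finset.mul_sum]
    rw [Finset.sum_comm]
    simp only [mul_assoc]
  let C : ℝ := 1 + ∑ k, ∑ l, ‖b k l‖
  have hC : 0 < C := by positivity
  have hbC : ∀ k l, ‖b k l‖ ≤ C := fun k l => by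
    have h1 : ‖b k l‖ ≤ ∑ l, ‖b k l‖ :=
      Finset.single_le_sum (f := fun l => ‖b k l‖) (fun l _ => norm_nonneg _) (Finset.mem_univ l)
    have h2 : ∑ l, ‖b k l‖ ≤ ∑ k, ∑ l, ‖b k l‖ :=
      Finset.single_le_sum (f := fun k => ∑ l, ‖b k l‖)
        (fun k _ => Finset.sum_nonneg fun l _ => norm_nonneg _) (Finset.mem_univ k)
    simp only [C]
    linarith
  obtain ⟨S', hS'm, hσS', hvS'⟩ := Measure.mutuallySingular_singularPart ρ volume
  set σ := ρ.singularPart volume with hσ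
  set α := volume.withDensity (ρ.rnDeriv volume) with hα
  have hρ : ρ = σ + α := (Measure.haveLebesgueDecomposition_add ρ volume)
  have hσρ : σ ≤ ρ := Measure.singularPart_le ρ volume
  have hαρ : α ≤ ρ := Measure.withDensity_rnDeriv_le ρ volume
  have hσac : σ ≪ ρ := Measure.absolutelyContinuous_of_le hσρ
  have hαac : α ≪ ρ := Measure.absolutelyContinuous_of_le hαρ
  have hαS : α S'ᶜ = 0 := withDensity_absolutelyContinuous _ _ hvS'
  have hfinσ : IsFiniteMeasure σ := isFiniteMeasure_of_le ρ hσρ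
  have hfinα : IsFiniteMeasure α := isFiniteMeasure_of_le ρ hαρ
  have hσmem : ∀ᵐ x ∂σ, x ∈ S'ᶜ := by
    rw [ae_iff]; simpa using hσS'
  have hαmem : ∀ᵐ x ∂α, x ∈ S' := by
    rw [ae_iff]; exact hαS
  have hρS : ρ.restrict S'ᶜ = σ := by
    conv_lhs => rw [hρ]
    rw [Measure.restrict_add, Measure.restrict_eq_zero.2 hαS, add_zero,
      Measure.restrict_eq_self_of_ae_mem hσmem]
  let f' := hf.mk f
  have hf'm : Measurable f' := hf.stronglyMeasurable_mk.measurable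
  have hff' : f =ᵐ[ρ] f' := hf.ae_eq_mk
  let h : EuclideanSpace ℝ (Fin d) → EuclideanSpace ℝ (Fin m) :=
    fun x => S'ᶜ.indicator (fun _ => P₀) x - f' x
  have hhm : Measurable h := (measurable_const.indicator hS'm.compl).sub hf'm
  have hhσ : ∀ᵐ x ∂σ, ‖h x‖ = ‖f x - P₀‖ := by
    filter_upwards [hσmem, hσac.ae_le hff'] with x h1 h2
    simp only [h, Set.indicator_of_mem h1, ← h2]
    exact norm_sub_rev _ _
  have hhα : ∀ᵐ x ∂α, ‖h x‖ = 1 := by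
    filter_upwards [hαmem, hαac.ae_le hff', hαac.ae_le hpolar] with x h1 h2 h3
    have h4 : x ∉ S'ᶜ := fun h => h h1
    simp only [h, Set.indicator_of_notMem h4, ← h2]
    simpa using h3
  have hf'1 : ∀ᵐ x ∂ρ, ‖f' x‖ = 1 := by
    filter_upwards [hff', hpolar] with x h1 h2
    rw [← h1, h2]
  have hhb : ∀ᵐ x ∂ρ, ‖h x‖ ≤ ‖P₀‖ + 1 := by
    filter_upwards [hf'1] with x h1
    refine (norm_sub_le _ _).trans (add_le_add ?_ h1.le)
    exact norm_indicator_le_norm_self (fun _ => P₀) x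
  have hhi : Integrable (fun x => ‖h x‖) ρ := by
    refine Integrable.of_bound hhm.norm.aestronglyMeasurable (‖P₀‖ + 1) ?_
    simpa using hhb
  have hdm : Measurable fun x => ENNReal.ofReal (C * ‖h x‖) :=
    (hhm.norm.const_mul C).ennreal_ofReal
  refine ⟨C, ρ.withDensity fun x => ENNReal.ofReal (C * ‖h x‖),
    fun k l x => inner ℝ (b k l) (h x) / (C * ‖h x‖), hC.le,
    isFiniteMeasure_withDensity_ofReal (hhi.const_mul C).2, fun k l => ?_, fun k l x => ?_,
    fun φ hφ hφc hφΩ k => ?_, fun B hB => ?_⟩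
  · exact (Measurable.const_inner hhm).div (hhm.norm.const_mul C)
  · rw [abs_div, abs_of_nonneg (a := C * ‖h x‖) (by positivity)]
    refine div_le_one_of_le₀ ((abs_real_inner_le_norm _ _).trans ?_) (by positivity)
    exact mul_le_mul_of_nonneg_right (hbC k l) (norm_nonneg _)
  · have hpc : ∀ l, Continuous (pderiv' l φ) := fun l =>
      (hφ.continuous_fderiv (by simp)).clm_apply continuous_const
    have hps : ∀ l, HasCompactSupport (pderiv' l φ) := fun l => hφc.fderiv_apply ℝ _
    have hpi : ∀ l, Integrable (pderiv' l φ) ρ := fun l =>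
      (hpc l).integrable_of_hasCompactSupport (hps l)
    have hpf : ∀ l j, Integrable (fun x => pderiv' l φ x * f' x j) ρ := fun l j => by
      refine (hpi l).mul_bdd (c := 1) ?_ ?_
      · exact (PiLp.continuous_apply 2 _ j).measurable.comp hf'm |>.aestronglyMeasurable
      · filter_upwards [hf'1] with x h1
        exact (PiLp.norm_apply_le _ _).trans h1.le
    have hpS : ∀ l, Integrable (S'ᶜ.indicator (pderiv' l φ)) ρ := fun l =>
      (hpi l).indicator hS'm.compl
    have key : ∀ l, ∫ x, pderiv' l φ x * (inner ℝ (b k l) (h x) / (C * ‖h x‖))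
          ∂(ρ.withDensity fun x => ENNReal.ofReal (C * ‖h x‖))
        = (if k = l then 1 else 0) * (∫ x, pderiv' l φ x ∂σ)
          - ∑ j, b k l j * ∫ x, pderiv' l φ x * f' x j ∂ρ := fun l => by
      rw [integral_withDensity_eq_integral_toReal_smul hdm (by simp)]
      have : ∀ x, (ENNReal.ofReal (C * ‖h x‖)).toReal •
          (pderiv' l φ x * (inner ℝ (b k l) (h x) / (C * ‖h x‖)))
          = (if k = l then 1 else 0) * S'ᶜ.indicator (pderiv' l φ) x
            - ∑ j, b k l j * (pderiv' l φ x * f' x j) := fun x => by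
        rw [ENNReal.toReal_ofReal (by positivity), smul_eq_mul]
        have e1 : C * ‖h x‖ * (pderiv' l φ x * (inner ℝ (b k l) (h x) / (C * ‖h x‖)))
            = pderiv' l φ x * inner ℝ (b k l) (h x) := by
          by_cases h0 : h x = 0
          · simp [h0]
          · have := norm_pos_iff.2 h0
            field_simp
        have e2 : inner ℝ (b k l) P₀ = if k = l then (1 : ℝ) else 0 := by
          rw [← hbP k l, PiLp.inner_apply]
          simp [mul_comm]
        have e3 : inner ℝ (b k l) (f' x) = ∑ j, b k l j * f' x j := by
          rw [PiLp.inner_apply]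
          simp [mul_comm]
        rw [e1]
        simp only [h, inner_sub_right, e3]
        have e4 : ∑ j, b k l j * (pderiv' l φ x * f' x j)
            = pderiv' l φ x * ∑ j, b k l j * f' x j := by
          rw [Finset.mul_sum]
          exact Finset.sum_congr rfl fun j _ => by ring
        rw [e4]
        by_cases hx : x ∈ S'ᶜ
        · simp only [Set.indicator_of_mem hx, e2]; ring
        · simp only [Set.indicator_of_notMem hx, inner_zero_right]; ring
      simp only [this]
      rw [integral_sub ((hpS l).const_mul _)
        (integrable_finsetSum _ fun j _ => (hpf l j).const_mul _), integral_const_mul,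
        integral_indicator hS'm.compl, hρS, integral_finsetSum _
          fun j _ => (hpf l j).const_mul _]
      simp only [integral_const_mul]
    have hz : ∑ l, ∑ j, b k l j * ∫ x, pderiv' l φ x * f' x j ∂ρ = 0 := by
      have e1 : ∀ l j, ∫ x, pderiv' l φ x * f' x j ∂ρ = ∫ x, pderiv' l φ x * f x j ∂ρ :=
        fun l j => integral_congr_ae (by filter_upwards [hff'] with x hx; rw [hx])
      simp only [e1, b, Finset.sum_mul]
      have e2 : ∀ i, ∑ l, ∑ j, L k i * A l i j * ∫ x, pderiv' l φ x * f x j ∂ρ = 0 := fun i => by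
        have := hfree φ hφ hφc hφΩ i
        simp only [mul_assoc, ← Finset.mul_sum]
        rw [this, mul_zero]
      rw [← Finset.sum_eq_zero fun i (_ : i ∈ Finset.univ) => e2 i, Finset.sum_comm]
      rw [Finset.sum_comm]
      refine (Finset.sum_congr rfl fun l _ => Finset.sum_comm).trans Finset.sum_comm
    simp only [key, Finset.sum_sub_distrib, hz, sub_zero]
    simp
  · rw [Measure.real, withDensity_apply _ hB, ← ofReal_integral_eq_lintegral_ofReal
      (hhi.const_mul C).restrict (ae_of_all _ fun x => by positivity),
      ENNReal.toReal_ofReal (integral_nonneg fun x => by positivity), integral_const_mul]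
    refine mul_le_mul_of_nonneg_left (le_of_eq ?_) hC.le
    conv_lhs => rw [hρ, Measure.restrict_add]
    have hiσ : Integrable (fun x => ‖h x‖) (σ.restrict B) := (hhi.mono_measure hσρ).restrict
    have hiα : Integrable (fun x => ‖h x‖) (α.restrict B) := (hhi.mono_measure hαρ).restrict
    rw [integral_add_measure hiσ hiα, integral_congr_ae (ae_restrict_of_ae hhσ),
      integral_congr_ae (ae_restrict_of_ae hhα)]
    simp

end Reduction

section Final
variable {d : ℕ}

theorem eventually_le_real_ball_of_tendsto {ν : Measure (EuclideanSpace ℝ (Fin d))}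
    [IsFiniteMeasure ν] {ν' : ℕ → Measure (EuclideanSpace ℝ (Fin d))}
    [∀ j, IsFiniteMeasure (ν' j)]
    (hweak : ∀ φ : EuclideanSpace ℝ (Fin d) → ℝ,
      Continuous φ → HasCompactSupport φ → tsupport φ ⊆ ball 0 1 →
        Tendsto (fun j => ∫ x, φ x ∂(ν' j)) atTop (𝓝 (∫ x, φ x ∂ν)))
    (hν : 0 < ν (ball 0 (1 / 2))) :
    ∃ a : ℝ, 0 < a ∧ ∀ᶠ j in atTop, a ≤ (ν' j).real (ball 0 (1 / 2)) := by
  let φ : EuclideanSpace ℝ (Fin d) → ℝ := fun x => max 0 (1 / 2 - ‖x‖)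
  have hφ : Continuous φ := by fun_prop
  have hφ0 : ∀ x, 0 ≤ φ x := fun x => le_max_left _ _
  have hsupp : Function.support φ = ball 0 (1 / 2) := by
    ext x
    rw [Function.mem_support, mem_ball_zero_iff]
    constructor
    · intro h
      by_contra hx
      exact h (max_eq_left (by linarith))
    · intro h
      exact (lt_max_of_lt_right (by linarith)).ne'
  have hts : tsupport φ ⊆ closedBall 0 (1 / 2) := by
    rw [tsupport, hsupp]
    exact closure_ball_subset_closedBall
  have hφc : HasCompactSupport φ :=
    (isCompact_closedBall 0 (1 / 2)).of_isClosed_subset (isClosed_tsupport _) hts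
  have hI : 0 < ∫ x, φ x ∂ν := by
    rw [integral_pos_iff_support_of_nonneg hφ0 (hφ.integrable_of_hasCompactSupport hφc), hsupp]
    exact hν
  refine ⟨(∫ x, φ x ∂ν) / 2, half_pos hI, ?_⟩
  have ht := hweak φ hφ hφc (hts.trans (closedBall_subset_ball (by norm_num)))
  filter_upwards [ht.eventually (lt_mem_nhds (half_lt_self hI))] with j hj
  refine hj.le.trans ?_
  rw [← setIntegral_eq_integral_of_forall_compl_eq_zero (s := ball 0 (1 / 2))
    fun x hx => Function.notMem_support.1 (hsupp ▸ hx)]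
  have h1 := norm_setIntegral_le_of_norm_le_const (f := φ) (μ := ν' j) (s := ball 0 (1 / 2))
    (C := 1) (measure_lt_top _ _) fun x _ => by
      rw [Real.norm_of_nonneg (hφ0 x)]
      exact max_le zero_le_one (by linarith [norm_nonneg x])
  rw [one_mul] at h1
  exact (le_abs_self _).trans h1

end Final

end

/-- **The key blow-up step for first-order operators.**
Let `𝒜 = ∑ A_ℓ ∂_ℓ` be first-order homogeneous and let `μ = f·ρ` (with `ρ = |μ|`,
`‖f‖ = 1` `ρ`-a.e.) be an `𝒜`-free measure on the open set `Ω ∋ 0`.  Write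
`ρ^s = ρ.singularPart volume` and `ρ^a = volume.withDensity (ρ.rnDeriv volume)` for the
singular and absolutely continuous parts of `ρ = |μ|`, and let `P₀` be the polar at `0`
(its defining property enters through hypothesis (i)).  Assume, for radii `r_j ↓ 0`
with `B_{r_j}(0) ⊆ Ω`:
(i) `ρ^a(B_{r_j})/ρ^s(B_{r_j}) → 0` and `⨍_{B_{r_j}} ‖f − P₀‖ dρ^s → 0`;
(ii) the blow-ups `ν_j := ρ^s(B_{r_j})⁻¹ · (T^{0,r_j})_♯ ρ^s`, restricted to `B₁`,
converge weakly* to a finite positive Radon measure `ν` with `ν(B_{1/2}) > 0`;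
(iii) the ellipticity bound `‖𝔸(ξ)P₀‖ ≥ c‖ξ‖` holds (Euclidean norms).
Then `ν ⌞ B_{1/2}` is nonzero and absolutely continuous w.r.t. Lebesgue measure, and
`ν_j → ν` in total variation on `B_{1/2}`, i.e.
`|ν_j − ν|(B_{1/2}) = ν_j(B_{1/2}) + ν(B_{1/2}) − 2(ν_j ⊓ ν)(B_{1/2}) → 0`. -/
theorem statement15 {d m n : ℕ}
    (A : Fin d → Matrix (Fin n) (Fin m) ℝ)
    (Ω : Set (EuclideanSpace ℝ (Fin d))) (hΩ : IsOpen Ω) (h0 : 0 ∈ Ω)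
    (ρ : Measure (EuclideanSpace ℝ (Fin d))) [IsFiniteMeasure ρ] (hρΩ : ρ Ωᶜ = 0)
    (f : EuclideanSpace ℝ (Fin d) → EuclideanSpace ℝ (Fin m))
    (hf : AEStronglyMeasurable f ρ)
    (hpolar : ∀ᵐ x ∂ρ, ‖f x‖ = 1)
    (hfree : ∀ φ : EuclideanSpace ℝ (Fin d) → ℝ,
      ContDiff ℝ (⊤ : ℕ∞) φ → HasCompactSupport φ → tsupport φ ⊆ Ω →
      ∀ i : Fin n, ∑ l, ∑ j, A l i j * ∫ x, pderiv' l φ x * f x j ∂ρ = 0)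
    (P₀ : EuclideanSpace ℝ (Fin m))
    (r : ℕ → ℝ) (hrpos : ∀ j, 0 < r j) (hrlim : Tendsto r atTop (𝓝 0))
    (hrball : ∀ j, ball (0 : EuclideanSpace ℝ (Fin d)) (r j) ⊆ Ω)
    (hspos : ∀ j, 0 < ρ.singularPart volume (ball 0 (r j)))
    -- (i)
    (hi1 : Tendsto (fun j =>
        (volume.withDensity (ρ.rnDeriv volume) (ball (0 : EuclideanSpace ℝ (Fin d)) (r j))).toReal
          / (ρ.singularPart volume (ball (0 : EuclideanSpace ℝ (Fin d)) (r j))).toReal)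
      atTop (𝓝 0))
    (hi2 : Tendsto (fun j =>
        (ρ.singularPart volume (ball (0 : EuclideanSpace ℝ (Fin d)) (r j))).toReal⁻¹
          * ∫ x in ball (0 : EuclideanSpace ℝ (Fin d)) (r j), ‖f x - P₀‖ ∂(ρ.singularPart volume))
      atTop (𝓝 0))
    -- (ii)
    (ν' : ℕ → Measure (EuclideanSpace ℝ (Fin d)))
    (hν' : ∀ j, ν' j = (ρ.singularPart volume (ball 0 (r j)))⁻¹ •
      ((Measure.map (fun x : EuclideanSpace ℝ (Fin d) => (r j)⁻¹ • x)
        (ρ.singularPart volume)).restrict (ball 0 1)))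
    (ν : Measure (EuclideanSpace ℝ (Fin d))) [IsFiniteMeasure ν]
    (hweak : ∀ φ : EuclideanSpace ℝ (Fin d) → ℝ,
      Continuous φ → HasCompactSupport φ → tsupport φ ⊆ ball 0 1 →
        Tendsto (fun j => ∫ x, φ x ∂(ν' j)) atTop (𝓝 (∫ x, φ x ∂ν)))
    (hν12 : 0 < ν (ball 0 (1 / 2)))
    -- (iii)
    (c : ℝ) (hc : 0 < c)
    (hell : ∀ ξ : EuclideanSpace ℝ (Fin d),
      c * ‖ξ‖ ≤ Real.sqrt (∑ i, (∑ l, ξ l * ∑ j, A l i j * P₀ j) ^ 2)) :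
    ν.restrict (ball 0 (1 / 2)) ≠ 0 ∧
    ν.restrict (ball 0 (1 / 2)) ≪ volume ∧
    Tendsto (fun j => ν' j (ball 0 (1 / 2)) + ν (ball 0 (1 / 2))
        - 2 * (ν' j ⊓ ν) (ball 0 (1 / 2))) atTop (𝓝 0) := by
  exfalso
  have hd : 0 < d := by
    rcases Nat.eq_zero_or_pos d with rfl | hd
    · obtain ⟨S, -, h1, h2⟩ := Measure.mutuallySingular_singularPart ρ volume
      rcases Set.eq_empty_or_nonempty Sᶜ with hS | ⟨x, hx⟩
      · rw [Set.compl_empty_iff.1 hS] at h1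
        exact absurd (measure_mono_null (Set.subset_univ _) h1) (hspos 0).ne'
      · refine absurd (measure_mono_null (fun y _ => ?_) h2)
          (measure_ball_pos volume (0 : EuclideanSpace ℝ (Fin 0)) one_pos).ne'
        exact Subsingleton.elim x y ▸ hx
    · exact hd
  obtain ⟨C, τ, q, hC, hτ, hqm, hq1, hrep, hτB⟩ :=
    exists_gradient_representation hf hpolar hfree hc hell
  have hw : ∀ j, (ρ.singularPart volume (ball 0 (r j)))⁻¹ ≠ ⊤ := fun j =>
    ENNReal.inv_ne_top.2 (hspos j).ne'
  have hfin : ∀ j, IsFiniteMeasure (ν' j) := fun j => by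
    rw [hν' j]
    exact isFiniteMeasure_rescale (hw j)
  obtain ⟨a, ha, haν⟩ := eventually_le_real_ball_of_tendsto hweak hν12
  obtain ⟨ε, hε, hnot⟩ := exists_not_gradEqDiv hd ha
  have hlim := (hi2.add hi1).const_mul C
  rw [add_zero, mul_zero] at hlim
  obtain ⟨j, hj1, hj2⟩ := (haν.and (hlim.eventually (gt_mem_nhds hε))).exists
  have hτj : IsFiniteMeasure (rescale (ρ.singularPart volume (ball 0 (r j)))⁻¹ (r j) τ) :=
    isFiniteMeasure_rescale (hw j)
  refine hnot (ν' j) (rescale (ρ.singularPart volume (ball 0 (r j)))⁻¹ (r j) τ)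
    (fun k l x => q k l (r j • x)) (fun k l => (hqm k l).comp (measurable_const_smul _))
    (fun k l x => hq1 k l _) ?_ hj1 ?_ ?_
  · rw [hν' j]
    exact mutuallySingular_rescale (hrpos j) (Measure.mutuallySingular_singularPart ρ volume)
  · rw [rescale_real_univ (hrpos j), ENNReal.toReal_inv]
    refine (mul_le_mul_of_nonneg_left (hτB _ measurableSet_ball)
      (inv_nonneg.2 ENNReal.toReal_nonneg)).trans (le_of_eq_of_le ?_ hj2.le)
    rw [Measure.real, div_eq_inv_mul]
    ring
  · rw [hν' j]
    exact gradEqDiv_rescale (hrpos j) fun φ hφ hφc hφs k =>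
      hrep φ hφ hφc (hφs.trans (hrball j)) k
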